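/- A real binary form f(x,y) of degree n ≥ 3 without multiple complex roots has real Waring rank n if and only if f has n distinct real roots. -/

import Mathlib

open MvPolynomial

/-- The real linear binary form `p.1 * x + p.2 * y`. -/
noncomputable def lin (p : ℝ × ℝ) : MvPolynomial (Fin 2) ℝ :=
  C p.1 * X 0 + C p.2 * X 1

/-- A binary form `f` has `m` distinct real roots: it factors over `ℝ` into `m`
pairwise non-proportional (nonzero) real linear forms, up to a nonzero constant. -/
noncomputable def HasDistinctRealRoots (f : MvPolynomial (Fin 2) ℝ) (m : ℕ) : Prop :=
  ∃ (c : ℝ) (l : Fin m → ℝ × ℝ), c ≠ 0 ∧ (∀ i, l i ≠ 0) ∧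
    (∀ i j, i ≠ j → (l i).1 * (l j).2 - (l j).1 * (l i).2 ≠ 0) ∧
    f = C c * ∏ i, lin (l i)
/-- `f` admits a real Waring decomposition with `r` summands of `n`-th powers of
real linear forms. -/
noncomputable def WaringDecomp (f : MvPolynomial (Fin 2) ℝ) (n r : ℕ) : Prop :=
  ∃ (lam : Fin r → ℝ) (l : Fin r → ℝ × ℝ),
    f = ∑ i, C (lam i) * (lin (l i)) ^ n

/-- The real Waring rank of a binary form of degree `n`. -/
noncomputable def RealRank (f : MvPolynomial (Fin 2) ℝ) (n : ℕ) : ℕ :=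
  sInf {r | WaringDecomp f n r}

/-- The determinant of two vectors of the plane. -/
def cross (v w : ℝ × ℝ) : ℝ := v.1 * w.2 - w.1 * v.2

/-- The linear form `v.2 * x - v.1 * y`, which vanishes exactly on the line spanned by `v`. -/
noncomputable def annForm (v : ℝ × ℝ) : MvPolynomial (Fin 2) ℝ := lin (v.2, -v.1)

/-- Evaluation of a polynomial at a vector of the plane, as a linear functional. -/
noncomputable def evalAt (v : ℝ × ℝ) : MvPolynomial (Fin 2) ℝ →ₗ[ℝ] ℝ :=
  (aeval ![v.1, v.2]).toLinearMap

lemma evalAt_apply (v : ℝ × ℝ) (g : MvPolynomial (Fin 2) ℝ) :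
    evalAt v g = eval ![v.1, v.2] g := by
  simp [evalAt, aeval_eq_eval]

lemma evalAt_mul (v : ℝ × ℝ) (g h : MvPolynomial (Fin 2) ℝ) :
    evalAt v (g * h) = evalAt v g * evalAt v h := by
  simp [evalAt_apply]

lemma evalAt_lin (v p : ℝ × ℝ) : evalAt v (lin p) = p.1 * v.1 + p.2 * v.2 := by
  simp [evalAt_apply, lin]

lemma evalAt_annForm (v w : ℝ × ℝ) : evalAt w (annForm v) = cross w v := by
  simp only [annForm, evalAt_lin, cross]; ring

lemma evalAt_prod {ι : Type*} (s : Finset ι) (v : ℝ × ℝ) (g : ι → MvPolynomial (Fin 2) ℝ) :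
    evalAt v (∏ i ∈ s, g i) = ∏ i ∈ s, evalAt v (g i) := by
  simp [evalAt_apply]

lemma isHomogeneous_lin (p : ℝ × ℝ) : (lin p).IsHomogeneous 1 :=
  (isHomogeneous_C_mul_X _ _).add (isHomogeneous_C_mul_X _ _)

lemma isHomogeneous_annForm (v : ℝ × ℝ) : (annForm v).IsHomogeneous 1 := isHomogeneous_lin _

lemma isHomogeneous_prod {ι : Type*} (s : Finset ι) (g : ι → MvPolynomial (Fin 2) ℝ)
    (hg : ∀ i, (g i).IsHomogeneous 1) : (∏ i ∈ s, g i).IsHomogeneous s.card := by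
  simpa using IsHomogeneous.prod s g (fun _ => 1) (fun i _ => hg i)

lemma lin_eq_annForm (p : ℝ × ℝ) : lin p = annForm (-p.2, p.1) := by
  simp [annForm]

lemma lin_smul_add (a b : ℝ) (p q : ℝ × ℝ) : lin (a • p + b • q) = C a * lin p + C b * lin q := by
  simp only [lin, Prod.fst_add, Prod.snd_add, Prod.smul_fst, Prod.smul_snd, smul_eq_mul, C_add,
    C_mul]
  ring

lemma lin_smul (a : ℝ) (p : ℝ × ℝ) : lin (a • p) = C a * lin p := by
  simpa using lin_smul_add a 0 p 0

lemma annForm_smul (a : ℝ) (v : ℝ × ℝ) : annForm (a • v) = C a * annForm v := by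
  rw [annForm, annForm, ← lin_smul]; simp

lemma exists_smul_of_cross_eq_zero {v w : ℝ × ℝ} (hv : v ≠ 0) (h : cross v w = 0) :
    ∃ c : ℝ, w = c • v := by
  have hv' : v.1 ≠ 0 ∨ v.2 ≠ 0 := by
    by_contra! hc
    exact hv (Prod.ext hc.1 hc.2)
  unfold cross at h
  rcases hv' with h1 | h2
  · refine ⟨w.1 / v.1, Prod.ext ?_ ?_⟩ <;> simp only [Prod.smul_fst, Prod.smul_snd, smul_eq_mul]
    · field_simp
    · field_simp; linarith
  · refine ⟨w.2 / v.2, Prod.ext ?_ ?_⟩ <;> simp only [Prod.smul_fst, Prod.smul_snd, smul_eq_mul]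
    · field_simp; linarith
    · field_simp

section Divisibility

lemma aeval_mul_of_isHomogeneous {R : Type*} [CommRing R] [Algebra ℝ R]
    {g : MvPolynomial (Fin 2) ℝ} {n : ℕ} (hg : g.IsHomogeneous n) (c : R) (a : Fin 2 → R) :
    aeval (fun i => c * a i) g = c ^ n * aeval a g := by
  rw [aeval_def, aeval_def, eval₂_eq', eval₂_eq', Finset.mul_sum]
  refine Finset.sum_congr rfl fun d hd => ?_
  have h1 : n = d 0 + d 1 := by
    have := hg.degree_eq_sum_deg_support hd
    rw [this]
    exact (Finsupp.sum_fintype d (fun _ x => x) (by simp)).trans (Fin.sum_univ_two _)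
  simp only [Fin.prod_univ_two, mul_pow, h1, pow_add]
  ring

lemma sub_mem_ideal_of_aeval {R : Type*} [CommRing R] [Algebra ℝ R] (I : Ideal R)
    (g : MvPolynomial (Fin 2) ℝ) (a b : Fin 2 → R) (h : ∀ i, a i - b i ∈ I) :
    aeval a g - aeval b g ∈ I := by
  rw [← Ideal.Quotient.eq, ← Ideal.Quotient.mkₐ_eq_mk ℝ, ← AlgHom.comp_apply, ← AlgHom.comp_apply,
    comp_aeval, comp_aeval]
  have : (fun i => Ideal.Quotient.mkₐ ℝ I (a i)) = fun i => Ideal.Quotient.mkₐ ℝ I (b i) := by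
    funext i
    simpa [Ideal.Quotient.eq] using h i
  rw [this]

lemma annForm_dvd {g : MvPolynomial (Fin 2) ℝ} {n : ℕ} (hg : g.IsHomogeneous n) {v : ℝ × ℝ}
    (hv : v ≠ 0) (h : evalAt v g = 0) : annForm v ∣ g := by
  have key : ∀ j : Fin 2, ![v.1, v.2] j ≠ 0 → annForm v ∣ g := by
    intro j hj
    have h1 := sub_mem_ideal_of_aeval (Ideal.span {annForm v}) g
      (fun i => C (![v.1, v.2] j) * X i) (fun i => X j * C (![v.1, v.2] i)) (by
        intro i
        rw [Ideal.mem_span_singleton]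
        fin_cases i <;> fin_cases j
        · simp [mul_comm]
        · exact ⟨1, by simp [annForm, lin]; ring⟩
        · exact ⟨-1, by simp [annForm, lin]; ring⟩
        · simp [mul_comm])
    rw [aeval_mul_of_isHomogeneous hg, aeval_mul_of_isHomogeneous hg] at h1
    have h2 : aeval (fun i => C (![v.1, v.2] i)) g = (C (evalAt v g) : MvPolynomial (Fin 2) ℝ) := by
      rw [evalAt_apply, ← aeval_eq_eval]
      exact aeval_algebraMap_apply (MvPolynomial (Fin 2) ℝ) ![v.1, v.2] g
    rw [h2, h, C_0, mul_zero, sub_zero, aeval_X_left_apply, Ideal.mem_span_singleton, ← C_pow] at h1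
    refine (IsUnit.dvd_mul_left ?_).1 h1
    exact (IsUnit.mk0 _ (pow_ne_zero n hj)).map C
  have hv' : v.1 ≠ 0 ∨ v.2 ≠ 0 := by
    by_contra! hc
    exact hv (Prod.ext hc.1 hc.2)
  exact hv'.elim (key 0) (key 1)

attribute [local instance] MvPolynomial.gradedAlgebra in
lemma exists_isHomogeneous_right_factor {p q : MvPolynomial (Fin 2) ℝ} {i n : ℕ}
    (hp : p.IsHomogeneous i) (hpq : (p * q).IsHomogeneous (i + n)) :
    ∃ r, r.IsHomogeneous n ∧ p * q = p * r := by
  refine ⟨homogeneousComponent n q, homogeneousComponent_isHomogeneous _ _, ?_⟩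
  have h := DirectSum.coe_decompose_mul_of_left_mem_of_le
    (homogeneousSubmodule (Fin 2) ℝ) (b := q) hp (Nat.le_add_right i n)
  rw [Nat.add_sub_cancel_left] at h
  rw [← homogeneousComponent_eq_self (n := i + n) hpq]
  exact (decomposition.decompose'_apply _ _).symm.trans
    (h.trans (congrArg (p * ·) (decomposition.decompose'_apply _ _)))

/-- A form vanishing on pairwise distinct lines is divisible by the product of their equations. -/
lemma exists_eq_prod_annForm_mul {r : ℕ} (v : Fin r → ℝ × ℝ) (hv : ∀ i, v i ≠ 0)
    (hvw : ∀ i j, i ≠ j → cross (v i) (v j) ≠ 0) {k : ℕ} {g : MvPolynomial (Fin 2) ℝ}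
    (hg : g.IsHomogeneous (r + k)) (h : ∀ i, evalAt (v i) g = 0) :
    ∃ q, q.IsHomogeneous k ∧ g = (∏ i, annForm (v i)) * q := by
  have key : ∀ s : Finset (Fin r), ∃ q, g = (∏ i ∈ s, annForm (v i)) * q := by
    intro s
    induction s using Finset.induction_on with
    | empty => exact ⟨g, by simp⟩
    | insert a s ha ih =>
      obtain ⟨q, hq⟩ := ih
      have hs : s.card ≤ r + k := by
        have := s.card_le_univ
        rw [Fintype.card_fin] at this
        lia
      obtain ⟨q', hq', e⟩ := exists_isHomogeneous_right_factor (q := q) (n := r + k - s.card)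
        (isHomogeneous_prod s _ fun i => isHomogeneous_annForm (v i))
        (by rwa [← hq, Nat.add_sub_cancel' hs])
      have h0 : evalAt (v a) q' = 0 := by
        have := h a
        rw [hq, e, evalAt_mul, evalAt_prod] at this
        refine (mul_eq_zero.1 this).resolve_left (Finset.prod_ne_zero_iff.2 fun i hi => ?_)
        rw [evalAt_annForm]
        exact hvw a i (by rintro rfl; exact ha hi)
      obtain ⟨q'', rfl⟩ := annForm_dvd hq' (hv a) h0
      exact ⟨q'', by rw [hq, e, Finset.prod_insert ha]; ring⟩
  obtain ⟨q, hq⟩ := key Finset.univ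
  have hP : (∏ i, annForm (v i)).IsHomogeneous r := by
    simpa using isHomogeneous_prod Finset.univ _ fun i => isHomogeneous_annForm (v i)
  obtain ⟨q', hq', e⟩ := exists_isHomogeneous_right_factor (q := q) (n := k) hP (by rwa [← hq])
  exact ⟨q', hq', hq.trans e⟩

end Divisibility

section Span

/-- On forms of degree `n`, a functional vanishing on the common kernel of finitely many others
is a linear combination of them. -/
lemma exists_eq_sum_of_forall_isHomogeneous {ι : Type*} [Fintype ι] (n : ℕ)
    (Λ : ι → MvPolynomial (Fin 2) ℝ →ₗ[ℝ] ℝ) (L : MvPolynomial (Fin 2) ℝ →ₗ[ℝ] ℝ)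
    (h : ∀ g : MvPolynomial (Fin 2) ℝ, g.IsHomogeneous n → (∀ i, Λ i g = 0) → L g = 0) :
    ∃ c : ι → ℝ, ∀ g : MvPolynomial (Fin 2) ℝ, g.IsHomogeneous n → L g = ∑ i, c i * Λ i g := by
  have := mem_span_of_iInf_ker_le_ker
    (L := fun i => (Λ i).comp (homogeneousSubmodule (Fin 2) ℝ n).subtype)
    (K := L.comp (homogeneousSubmodule (Fin 2) ℝ n).subtype) (by
      intro g hg
      simp only [Submodule.mem_iInf, LinearMap.mem_ker, LinearMap.comp_apply,
        Submodule.subtype_apply] at hg ⊢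
      exact h g g.2 hg)
  obtain ⟨c, hc⟩ := (Submodule.mem_span_range_iff_exists_fun ℝ).1 this
  refine ⟨c, fun g hg => ?_⟩
  have := LinearMap.congr_fun hc ⟨g, hg⟩
  simpa using this.symm

/-- Apolarity lemma: a functional on forms of degree `r + k` annihilating the ideal of the points
`v i` is a combination of evaluations at these points. -/
lemma exists_eq_sum_evalAt {r k : ℕ} (v : Fin r → ℝ × ℝ) (hv : ∀ i, v i ≠ 0)
    (hvw : ∀ i j, i ≠ j → cross (v i) (v j) ≠ 0) (L : MvPolynomial (Fin 2) ℝ →ₗ[ℝ] ℝ)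
    (h : ∀ q : MvPolynomial (Fin 2) ℝ, q.IsHomogeneous k → L ((∏ i, annForm (v i)) * q) = 0) :
    ∃ c : Fin r → ℝ, ∀ g : MvPolynomial (Fin 2) ℝ, g.IsHomogeneous (r + k) →
      L g = ∑ i, c i * evalAt (v i) g := by
  refine exists_eq_sum_of_forall_isHomogeneous (r + k) (fun i => evalAt (v i)) L fun g hg h0 => ?_
  obtain ⟨q, hq, rfl⟩ := exists_eq_prod_annForm_mul v hv hvw hg h0
  exact h q hq

end Span

section GeneratingForm

/-- Precomposition of a functional with multiplication by `p`. -/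
noncomputable def contract (p : MvPolynomial (Fin 2) ℝ) :
    (MvPolynomial (Fin 2) ℝ →ₗ[ℝ] ℝ) →ₗ[ℝ] (MvPolynomial (Fin 2) ℝ →ₗ[ℝ] ℝ) :=
  LinearMap.lcomp ℝ ℝ (LinearMap.mulLeft ℝ p)

@[simp]
lemma contract_apply (p g : MvPolynomial (Fin 2) ℝ) (L : MvPolynomial (Fin 2) ℝ →ₗ[ℝ] ℝ) :
    contract p L g = L (p * g) := rfl

lemma contract_comm (p q : MvPolynomial (Fin 2) ℝ) (L : MvPolynomial (Fin 2) ℝ →ₗ[ℝ] ℝ) :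
    contract p (contract q L) = contract q (contract p L) := by
  refine LinearMap.ext fun g => ?_
  simp only [contract_apply]
  ring_nf

lemma contract_lin (p : ℝ × ℝ) (L : MvPolynomial (Fin 2) ℝ →ₗ[ℝ] ℝ) :
    contract (lin p) L = p.1 • contract (X 0) L + p.2 • contract (X 1) L := by
  refine LinearMap.ext fun g => ?_
  simp only [contract_apply, LinearMap.add_apply, LinearMap.smul_apply, lin, add_mul, map_add,
    C_mul', smul_mul_assoc, map_smul]

/-- The binary form `L((xX + yY)ⁿ)` in `x, y` attached to a functional `L` on polynomials
in `X, Y`. -/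
noncomputable def genForm :
    ℕ → (MvPolynomial (Fin 2) ℝ →ₗ[ℝ] ℝ) →ₗ[ℝ] MvPolynomial (Fin 2) ℝ
  | 0 => Algebra.linearMap ℝ (MvPolynomial (Fin 2) ℝ) ∘ₗ LinearMap.applyₗ 1
  | n + 1 => LinearMap.mulLeft ℝ (X 0) ∘ₗ genForm n ∘ₗ contract (X 0) +
      LinearMap.mulLeft ℝ (X 1) ∘ₗ genForm n ∘ₗ contract (X 1)

lemma genForm_zero (L : MvPolynomial (Fin 2) ℝ →ₗ[ℝ] ℝ) : genForm 0 L = C (L 1) := rfl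

lemma genForm_succ (n : ℕ) (L : MvPolynomial (Fin 2) ℝ →ₗ[ℝ] ℝ) :
    genForm (n + 1) L =
      X 0 * genForm n (contract (X 0) L) + X 1 * genForm n (contract (X 1) L) := rfl

lemma isHomogeneous_genForm (n : ℕ) (L : MvPolynomial (Fin 2) ℝ →ₗ[ℝ] ℝ) :
    (genForm n L).IsHomogeneous n := by
  induction n generalizing L with
  | zero => exact isHomogeneous_C _ _
  | succ n ih =>
    rw [genForm_succ, add_comm n 1]
    exact ((isHomogeneous_X _ _).mul (ih _)).add ((isHomogeneous_X _ _).mul (ih _))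

lemma genForm_congr {n : ℕ} {L M : MvPolynomial (Fin 2) ℝ →ₗ[ℝ] ℝ}
    (h : ∀ g : MvPolynomial (Fin 2) ℝ, g.IsHomogeneous n → L g = M g) :
    genForm n L = genForm n M := by
  induction n generalizing L M with
  | zero => rw [genForm_zero, genForm_zero, h 1 (isHomogeneous_one _ _)]
  | succ n ih =>
    have key : ∀ i, genForm n (contract (X i) L) = genForm n (contract (X i) M) := fun i =>
      ih fun g hg => h _ (by rw [add_comm n 1]; exact (isHomogeneous_X _ _).mul hg)
    rw [genForm_succ, genForm_succ, key, key]

lemma genForm_evalAt (n : ℕ) (v : ℝ × ℝ) : genForm n (evalAt v) = lin v ^ n := by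
  induction n with
  | zero => simp [genForm_zero, evalAt_apply]
  | succ n ih =>
    have h0 : contract (X 0) (evalAt v) = v.1 • evalAt v := by
      refine LinearMap.ext fun g => ?_
      simp [evalAt_apply]
    have h1 : contract (X 1) (evalAt v) = v.2 • evalAt v := by
      refine LinearMap.ext fun g => ?_
      simp [evalAt_apply]
    rw [genForm_succ, h0, h1, map_smul, map_smul, ih, pow_succ, lin, smul_eq_C_mul, smul_eq_C_mul]
    ring

lemma genForm_eq_sum {n : ℕ} {ι : Type*} [Fintype ι] {c : ι → ℝ} {v : ι → ℝ × ℝ}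
    {L : MvPolynomial (Fin 2) ℝ →ₗ[ℝ] ℝ}
    (h : ∀ g : MvPolynomial (Fin 2) ℝ, g.IsHomogeneous n → L g = ∑ i, c i * evalAt (v i) g) :
    genForm n L = ∑ i, C (c i) * lin (v i) ^ n := by
  rw [genForm_congr (M := ∑ i, c i • evalAt (v i)) fun g hg => by simpa using h g hg, map_sum]
  exact Finset.sum_congr rfl fun i _ => by rw [map_smul, genForm_evalAt, smul_eq_C_mul]

lemma waringDecomp_genForm {r k : ℕ} (v : Fin r → ℝ × ℝ) (hv : ∀ i, v i ≠ 0)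
    (hvw : ∀ i j, i ≠ j → cross (v i) (v j) ≠ 0) (L : MvPolynomial (Fin 2) ℝ →ₗ[ℝ] ℝ)
    (h : ∀ q : MvPolynomial (Fin 2) ℝ, q.IsHomogeneous k → L ((∏ i, annForm (v i)) * q) = 0) :
    WaringDecomp (genForm (r + k) L) (r + k) r := by
  obtain ⟨c, hc⟩ := exists_eq_sum_evalAt v hv hvw L h
  exact ⟨c, v, genForm_eq_sum hc⟩

/-- The functional sending a monomial `m` to `m! * coeff m f`. -/
noncomputable def coeffFunctional (f : MvPolynomial (Fin 2) ℝ) :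
    MvPolynomial (Fin 2) ℝ →ₗ[ℝ] ℝ :=
  (basisMonomials (Fin 2) ℝ).constr ℝ
    fun m => coeff m f * ((m 0).factorial * (m 1).factorial : ℕ)

lemma coeffFunctional_monomial (f : MvPolynomial (Fin 2) ℝ) (m : Fin 2 →₀ ℕ) :
    coeffFunctional f (monomial m 1) = coeff m f * ((m 0).factorial * (m 1).factorial : ℕ) := by
  have := (basisMonomials (Fin 2) ℝ).constr_basis ℝ
    (fun m => coeff m f * (((m 0).factorial * (m 1).factorial : ℕ) : ℝ)) m
  rwa [coe_basisMonomials] at this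

lemma contract_coeffFunctional (f : MvPolynomial (Fin 2) ℝ) (i : Fin 2) :
    contract (X i) (coeffFunctional f) = coeffFunctional (pderiv i f) := by
  refine (basisMonomials (Fin 2) ℝ).ext fun m => ?_
  rw [coe_basisMonomials, contract_apply, X, monomial_mul, one_mul, coeffFunctional_monomial,
    coeffFunctional_monomial, coeff_pderiv, add_comm m]
  fin_cases i <;> simp [add_comm 1, Nat.factorial_succ] <;> ring

lemma genForm_coeffFunctional {n : ℕ} {f : MvPolynomial (Fin 2) ℝ} (hf : f.IsHomogeneous n) :
    genForm n (coeffFunctional f) = C (n.factorial : ℝ) * f := by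
  induction n generalizing f with
  | zero =>
    rw [← totalDegree_zero_iff_isHomogeneous, totalDegree_eq_zero_iff_eq_C] at hf
    have := coeffFunctional_monomial f 0
    rw [genForm_zero, hf]
    rw [hf] at this
    simpa using this
  | succ n ih =>
    have h := hf.sum_X_mul_pderiv
    rw [Fin.sum_univ_two, nsmul_eq_mul] at h
    rw [genForm_succ, contract_coeffFunctional, contract_coeffFunctional, ih hf.pderiv,
      ih hf.pderiv, Nat.factorial_succ, Nat.cast_mul, C_mul, mul_comm (C _) (C _), mul_assoc,
      map_natCast C (n + 1), ← h]
    ring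

lemma exists_genForm_eq {n : ℕ} {f : MvPolynomial (Fin 2) ℝ} (hf : f.IsHomogeneous n) :
    ∃ L, genForm n L = f := by
  refine ⟨(n.factorial : ℝ)⁻¹ • coeffFunctional f, ?_⟩
  rw [map_smul, genForm_coeffFunctional hf, ← smul_eq_C_mul, smul_smul,
    inv_mul_cancel₀ (by exact_mod_cast n.factorial_ne_zero), one_smul]

end GeneratingForm

section Dehomogenization

/-- The univariate polynomial `f(x, 1)`. -/
noncomputable def dehom : MvPolynomial (Fin 2) ℝ →ₐ[ℝ] Polynomial ℝ := aeval ![Polynomial.X, 1]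

lemma dehom_lin (p : ℝ × ℝ) :
    dehom (lin p) = Polynomial.C p.1 * Polynomial.X + Polynomial.C p.2 := by
  simp [dehom, lin, Polynomial.C_eq_algebraMap]

lemma dehom_C (c : ℝ) : dehom (C c) = Polynomial.C c := by
  simp [dehom, Polynomial.C_eq_algebraMap]

lemma eval_dehom (g : MvPolynomial (Fin 2) ℝ) (a : ℝ) :
    (dehom g).eval a = evalAt (a, 1) g := by
  have h : (Polynomial.aeval a).comp dehom = aeval ![a, 1] := by
    ext i
    fin_cases i <;> simp [dehom]
  rw [← Polynomial.coe_aeval_eq_eval]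
  exact DFunLike.congr_fun h g

lemma eq_zero_of_dehom_eq_zero {n : ℕ} {g : MvPolynomial (Fin 2) ℝ} (hg : g.IsHomogeneous n)
    (h : dehom g = 0) : g = 0 := by
  have h0 : X 1 * g = 0 := by
    refine MvPolynomial.funext fun x => ?_
    rw [map_mul, eval_X, map_zero]
    by_cases hx : x 1 = 0
    · rw [hx, zero_mul]
    · have h1 := eval_dehom g (x 0 / x 1)
      have h2 := aeval_mul_of_isHomogeneous hg (x 1) ![x 0 / x 1, 1]
      have h3 : (fun i => x 1 * ![x 0 / x 1, 1] i) = x := by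
        funext i
        fin_cases i
        · simp [mul_div_cancel₀ _ hx]
        · simp
      rw [h3, aeval_eq_eval, aeval_eq_eval] at h2
      change eval x g = _ * eval _ g at h2
      rw [h, Polynomial.eval_zero, evalAt_apply] at h1
      rw [h2, ← h1, mul_zero, mul_zero]
  exact (mul_eq_zero.1 h0).resolve_left (X_ne_zero 1)

lemma dehom_injOn {n : ℕ} {f g : MvPolynomial (Fin 2) ℝ} (hf : f.IsHomogeneous n)
    (hg : g.IsHomogeneous n) (h : dehom f = dehom g) : f = g :=
  sub_eq_zero.1 (eq_zero_of_dehom_eq_zero (hf.sub hg) (by rw [map_sub, h, sub_self]))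

lemma dehom_genForm_succ (n : ℕ) (L : MvPolynomial (Fin 2) ℝ →ₗ[ℝ] ℝ) :
    dehom (genForm (n + 1) L) = Polynomial.X * dehom (genForm n (contract (X 0) L)) +
      dehom (genForm n (contract (X 1) L)) := by
  rw [genForm_succ, map_add, map_mul, map_mul]
  simp [dehom]

lemma derivative_dehom_genForm (n : ℕ) (L : MvPolynomial (Fin 2) ℝ →ₗ[ℝ] ℝ) :
    Polynomial.derivative (dehom (genForm (n + 1) L)) =
      (n + 1) * dehom (genForm n (contract (X 0) L)) := by
  induction n generalizing L with
  | zero =>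
    rw [dehom_genForm_succ]
    simp [genForm_zero]
  | succ n ih =>
    rw [dehom_genForm_succ, Polynomial.derivative_add, Polynomial.derivative_mul, ih, ih,
      Polynomial.derivative_X, contract_comm (X 0) (X 1), dehom_genForm_succ n (contract (X 0) L)]
    push_cast
    ring

lemma natDegree_dehom_le {n : ℕ} {g : MvPolynomial (Fin 2) ℝ} (hg : g.IsHomogeneous n) :
    (dehom g).natDegree ≤ n := by
  obtain ⟨L, rfl⟩ := exists_genForm_eq hg
  clear hg
  induction n generalizing L with
  | zero => simp [genForm_zero]
  | succ n ih =>
    rw [dehom_genForm_succ]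
    refine (Polynomial.natDegree_add_le _ _).trans (max_le ?_ ((ih _).trans n.le_succ))
    refine Polynomial.natDegree_mul_le.trans ?_
    rw [Polynomial.natDegree_X, add_comm 1]
    exact Nat.succ_le_succ (ih _)

lemma exists_eq_prod_lin_of_splits {n : ℕ} {g : MvPolynomial (Fin 2) ℝ} (hg : g.IsHomogeneous n)
    (hs : (dehom g).Splits) :
    ∃ (c : ℝ) (l : Fin n → ℝ × ℝ), (∀ i, l i ≠ 0) ∧ g = C c * ∏ i, lin (l i) := by
  induction n generalizing g with
  | zero =>
    rw [← totalDegree_zero_iff_isHomogeneous, totalDegree_eq_zero_iff_eq_C] at hg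
    exact ⟨coeff 0 g, ![], by simp, by simpa using hg⟩
  | succ n ih =>
    by_cases g0 : g = 0
    · exact ⟨0, fun _ => (1, 0), by simp, by simp [g0]⟩
    have hroot : ∃ v : ℝ × ℝ, v ≠ 0 ∧ evalAt v g = 0 := by
      by_cases hd : (dehom g).degree = 0
      · obtain ⟨a, ha⟩ : ∃ a, dehom g = Polynomial.C a :=
          ⟨_, Polynomial.eq_C_of_degree_eq_zero hd⟩
        have : g = C a * X 1 ^ (n + 1) := by
          refine dehom_injOn hg ?_ ?_
          · simpa using (isHomogeneous_X_pow (R := ℝ) (1 : Fin 2) (n + 1)).C_mul a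
          · rw [ha, map_mul, dehom_C]; simp [dehom]
        exact ⟨(1, 0), by simp, by simp [this, evalAt_apply]⟩
      · obtain ⟨r, hr⟩ := hs.exists_eval_eq_zero hd
        exact ⟨(r, 1), by simp, by rw [← eval_dehom, hr]⟩
    obtain ⟨v, hv, hvg⟩ := hroot
    obtain ⟨q, rfl⟩ := annForm_dvd hg hv hvg
    obtain ⟨q', hq', e⟩ := exists_isHomogeneous_right_factor (n := n) (isHomogeneous_annForm v)
      (by rwa [add_comm 1])
    have h0 : dehom (annForm v * q) ≠ 0 := fun h => g0 (eq_zero_of_dehom_eq_zero hg h)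
    obtain ⟨c, l, hl, rfl⟩ := ih hq' (hs.of_dvd h0 (by rw [e, map_mul]; exact dvd_mul_left _ _))
    refine ⟨c, Fin.cons (v.2, -v.1) l, ?_, ?_⟩
    · intro i
      refine Fin.cases ?_ (fun j => ?_) i
      · rw [Fin.cons_zero]
        intro h
        simp only [Prod.mk_eq_zero, neg_eq_zero] at h
        exact hv (Prod.ext h.2 h.1)
      · rw [Fin.cons_succ]; exact hl j
    · rw [e, Fin.prod_univ_succ]
      simp only [Fin.cons_zero, Fin.cons_succ, annForm]
      ring

end Dehomogenization

section RealRootedPencil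

open Polynomial in
lemma splits_of_forall_im_eq_zero {q : ℝ[X]} (h : ∀ z : ℂ, Polynomial.aeval z q = 0 → z.im = 0) :
    q.Splits := by
  refine Polynomial.Splits.of_splits_map (algebraMap ℝ ℂ) (IsAlgClosed.splits _) fun z hz => ?_
  have hz' : Polynomial.aeval z q = 0 := by
    have := (Polynomial.mem_roots'.1 hz).2
    rwa [Polynomial.IsRoot.def, Polynomial.eval_map_algebraMap] at this
  exact ⟨z.re, Complex.ext (by simp) (by simp [h z hz'])⟩

/-- The squared sine of the angle under which the real point `r` is seen from `z`. -/
noncomputable def angleWeight (z : ℂ) (r : ℝ) : ℝ := z.im ^ 2 / Complex.normSq (z - r)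

lemma normSq_sub_ofReal (z : ℂ) (r : ℝ) :
    Complex.normSq (z - r) = (z.re - r) ^ 2 + z.im ^ 2 := by
  simp [Complex.normSq_apply]; ring

lemma angleWeight_pos {z : ℂ} (hz : z.im ≠ 0) (r : ℝ) : 0 < angleWeight z r := by
  rw [angleWeight, normSq_sub_ofReal]; positivity

lemma angleWeight_le_one {z : ℂ} (hz : z.im ≠ 0) (r : ℝ) : angleWeight z r ≤ 1 := by
  rw [angleWeight, normSq_sub_ofReal, div_le_one (by positivity)]
  nlinarith [sq_nonneg (z.re - r)]

lemma eq_re_of_angleWeight_eq_one {z : ℂ} (hz : z.im ≠ 0) {r : ℝ} (h : angleWeight z r = 1) :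
    r = z.re := by
  rw [angleWeight, normSq_sub_ofReal, div_eq_one_iff_eq (by positivity)] at h
  have : (z.re - r) ^ 2 = 0 := by linarith
  linarith [pow_eq_zero_iff (two_ne_zero) |>.1 this]

open Polynomial in
lemma im_logDeriv_of_splits {q : ℝ[X]} (hq : q.Splits) {z : ℂ}
    (h0 : Polynomial.aeval z q ≠ 0) :
    z.im * (Polynomial.aeval z (derivative q) / Polynomial.aeval z q).im =
      -(q.roots.map (angleWeight z)).sum := by
  have h := (hq.map (algebraMap ℝ ℂ)).eval_derivative_div_eval_of_ne_zero (x := z)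
    (by rwa [eval_map_algebraMap])
  rw [derivative_map, eval_map_algebraMap, eval_map_algebraMap, hq.roots_map] at h
  rw [h, Multiset.map_map]
  induction q.roots using Multiset.induction_on with
  | empty => simp
  | cons a s ih =>
    rw [Multiset.map_cons, Multiset.sum_cons, Multiset.map_cons, Multiset.sum_cons, Complex.add_im,
      mul_add, ih, neg_add]
    congr 1
    simp [angleWeight, Complex.inv_im]
    ring

lemma exists_pow_eq_one_im_ne_zero {N : ℕ} (hN : 3 ≤ N) : ∃ w : ℂ, w ^ N = 1 ∧ w.im ≠ 0 := by
  refine ⟨Complex.exp (2 * Real.pi * Complex.I / N),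
    (Complex.isPrimitiveRoot_exp N (by lia)).pow_eq_one, ?_⟩
  have h : (2 * Real.pi * Complex.I / N : ℂ) = ((2 * Real.pi / N : ℝ) : ℂ) * Complex.I := by
    push_cast; ring
  have hN' : (3 : ℝ) ≤ N := by exact_mod_cast hN
  rw [h, Complex.exp_ofReal_mul_I_im]
  refine (Real.sin_pos_of_pos_of_lt_pi (by positivity) ?_).ne'
  rw [div_lt_iff₀ (by linarith)]
  nlinarith [Real.pi_pos]

/-- If `f(x, 1)` has a nonreal root, `q₁` and `q₂` being its (dehomogenized) partial derivatives
up to scaling, then some nonzero directional derivative of `f` also has a nonreal root. -/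
lemma exists_nonreal_root_pencil {N : ℕ} (hN : 3 ≤ N) {q₁ q₂ : Polynomial ℝ}
    (hdeg : q₁.natDegree ≤ N)
    (hder : Polynomial.derivative q₂ =
      (N : Polynomial ℝ) * q₁ - Polynomial.X * Polynomial.derivative q₁) {z : ℂ} (hz : z.im ≠ 0)
    (h0 : z * Polynomial.aeval z q₁ + Polynomial.aeval z q₂ = 0) (hne : q₁ ≠ 0 ∨ q₂ ≠ 0) :
    ∃ a b : ℝ, Polynomial.C a * q₁ + Polynomial.C b * q₂ ≠ 0 ∧
      ∃ w : ℂ, w.im ≠ 0 ∧ Polynomial.aeval w (Polynomial.C a * q₁ + Polynomial.C b * q₂) = 0 := by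
  by_contra! hcon
  have hq₁ : q₁ ≠ 0 := by
    rintro rfl
    have hq₂ := hne.resolve_left (by simp)
    exact hcon 0 1 (by simpa using hq₂) z hz (by simpa using h0)
  have hA : Polynomial.aeval z q₁ ≠ 0 := by
    simpa using hcon 1 0 (by simpa using hq₁) z hz
  have hs₁ : q₁.Splits := splits_of_forall_im_eq_zero fun w hw => by
    by_contra hw'
    exact hcon 1 0 (by simpa using hq₁) w hw' (by simpa using hw)
  set R : Polynomial ℝ := Polynomial.C z.re * q₁ + Polynomial.C 1 * q₂ with hR
  have hzre : (z.re : ℂ) - z = -(z.im * Complex.I) := by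
    apply Complex.ext <;> simp
  have hzim : (z.im : ℂ) ≠ 0 := by exact_mod_cast hz
  have hRz : Polynomial.aeval z R = ((z.re : ℂ) - z) * Polynomial.aeval z q₁ := by
    have : Polynomial.aeval z R = z.re * Polynomial.aeval z q₁ + Polynomial.aeval z q₂ := by
      simp [hR]
    rw [this]; linear_combination h0
  have hRz0 : Polynomial.aeval z R ≠ 0 := by
    rw [hRz, hzre]
    exact mul_ne_zero (neg_ne_zero.2 (mul_ne_zero hzim Complex.I_ne_zero)) hA
  have hR0 : R ≠ 0 := by
    intro h
    rw [h] at hRz0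
    simp at hRz0
  have hsR : R.Splits := splits_of_forall_im_eq_zero fun w hw => by
    by_contra hw'
    exact hcon _ _ hR0 w hw' hw
  have hRd : Polynomial.aeval z (Polynomial.derivative R) =
      N * Polynomial.aeval z q₁ +
        ((z.re : ℂ) - z) * Polynomial.aeval z (Polynomial.derivative q₁) := by
    have : Polynomial.derivative R = Polynomial.C z.re * Polynomial.derivative q₁ +
        ((N : Polynomial ℝ) * q₁ - Polynomial.X * Polynomial.derivative q₁) := by
      rw [hR, Polynomial.derivative_add, Polynomial.derivative_C_mul,
        Polynomial.derivative_C_mul, hder]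
      simp
    rw [this]
    simp only [map_add, map_sub, map_mul, Polynomial.aeval_C, Polynomial.aeval_X,
      map_natCast, Complex.coe_algebraMap]
    ring
  have e₁ := im_logDeriv_of_splits hs₁ hA
  have e₂ := im_logDeriv_of_splits hsR hRz0
  have hratio : Polynomial.aeval z (Polynomial.derivative R) / Polynomial.aeval z R =
      ((N / z.im : ℝ) : ℂ) * Complex.I +
        Polynomial.aeval z (Polynomial.derivative q₁) / Polynomial.aeval z q₁ := by
    rw [hRd, hRz, hzre]
    push_cast
    have hI := Complex.I_ne_zero
    field_simp
    linear_combination (-(N : ℂ) * Polynomial.aeval z q₁) * Complex.I_sq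
  have hS : (q₁.roots.map (angleWeight z)).sum = N + (R.roots.map (angleWeight z)).sum := by
    rw [hratio, Complex.add_im, Complex.im_ofReal_mul, Complex.I_im, mul_add, e₁, mul_one,
      mul_div_cancel₀ _ hz] at e₂
    linarith
  have hcard : q₁.roots.card ≤ N := (Polynomial.card_roots' _).trans hdeg
  have hle : (q₁.roots.map (angleWeight z)).sum ≤ q₁.roots.card := by
    have := Multiset.sum_le_card_nsmul (q₁.roots.map (angleWeight z)) 1 (by
      intro x hx
      obtain ⟨r, -, rfl⟩ := Multiset.mem_map.1 hx
      exact angleWeight_le_one hz r)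
    simpa using this
  have hcard' : (q₁.roots.card : ℝ) ≤ N := by exact_mod_cast hcard
  have hnonneg : ∀ x ∈ R.roots.map (angleWeight z), 0 ≤ x := by
    intro x hx
    obtain ⟨r, -, rfl⟩ := Multiset.mem_map.1 hx
    exact (angleWeight_pos hz r).le
  have hRroots : R.roots = 0 := by
    refine Multiset.eq_zero_of_forall_notMem fun r hr => ?_
    have := Multiset.single_le_sum hnonneg _ (Multiset.mem_map_of_mem (angleWeight z) hr)
    linarith [angleWeight_pos hz r]
  obtain ⟨c, hc⟩ : ∃ c, R = Polynomial.C c := by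
    refine ⟨_, Polynomial.eq_C_of_natDegree_eq_zero ?_⟩
    rw [hsR.natDegree_eq_card_roots, hRroots, Multiset.card_zero]
  have hroots : q₁.roots = Multiset.replicate N z.re := by
    have h1 : (q₁.roots.map (angleWeight z)).sum = N := by
      have := Multiset.sum_nonneg hnonneg
      linarith
    have hcN : q₁.roots.card = N := by
      have : (N : ℝ) ≤ q₁.roots.card := by linarith
      exact le_antisymm hcard (by exact_mod_cast this)
    refine Multiset.eq_replicate.2 ⟨hcN, fun r hr => eq_re_of_angleWeight_eq_one hz ?_⟩
    by_contra hne1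
    have hlt : angleWeight z r < 1 := lt_of_le_of_ne (angleWeight_le_one hz r) hne1
    have := Multiset.sum_lt_sum (s := q₁.roots) (f := angleWeight z) (g := fun _ => 1)
      (fun i _ => angleWeight_le_one hz i) ⟨r, hr, hlt⟩
    simp [h1, hcN] at this
  set a := q₁.leadingCoeff with ha
  have ha0 : a ≠ 0 := Polynomial.leadingCoeff_ne_zero.2 hq₁
  have hq₁eq : q₁ = Polynomial.C a * (Polynomial.X - Polynomial.C z.re) ^ N := by
    conv_lhs => rw [hs₁.eq_prod_roots, hroots]
    simp [ha]
  have hc0 : c ≠ 0 := by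
    rintro rfl
    simp [hc] at hR0
  obtain ⟨ω, hω, hωi⟩ := exists_pow_eq_one_im_ne_zero hN
  have hF : Polynomial.C (z.re - c / a) * q₁ + Polynomial.C 1 * q₂ =
      Polynomial.C c * (1 - (Polynomial.X - Polynomial.C z.re) ^ N) := by
    have h1 : Polynomial.C (z.re - c / a) * q₁ + Polynomial.C 1 * q₂ =
        R - Polynomial.C (c / a) * q₁ := by
      rw [hR, Polynomial.C_sub]; ring
    have h2 : Polynomial.C (c / a) * q₁ =
        Polynomial.C c * (Polynomial.X - Polynomial.C z.re) ^ N := by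
      conv_lhs => rw [hq₁eq]
      rw [← mul_assoc, ← Polynomial.C_mul, div_mul_cancel₀ _ ha0]
    rw [h1, h2, hc]; ring
  refine hcon (z.re - c / a) 1 ?_ (z.re + ω) (by simpa using hωi) ?_
  · rw [hF]
    intro h
    have := congrArg (Polynomial.eval z.re) h
    simp [hc0, show N ≠ 0 by lia] at this
  · rw [hF]
    simp [hω]

end RealRootedPencil

section CubicForms

lemma exists_eq_lin_of_isHomogeneous_one {q : MvPolynomial (Fin 2) ℝ} (hq : q.IsHomogeneous 1) :
    ∃ p, q = lin p := by
  obtain ⟨L, rfl⟩ := exists_genForm_eq hq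
  refine ⟨(L (X 0), L (X 1)), ?_⟩
  rw [genForm_succ, genForm_zero, genForm_zero, lin, contract_apply, contract_apply]
  ring_nf

lemma apply_mul_eq_zero_of_isHomogeneous_one {L : MvPolynomial (Fin 2) ℝ →ₗ[ℝ] ℝ}
    {g : MvPolynomial (Fin 2) ℝ} (h0 : L (g * X 0) = 0) (h1 : L (g * X 1) = 0)
    {q : MvPolynomial (Fin 2) ℝ} (hq : q.IsHomogeneous 1) : L (g * q) = 0 := by
  obtain ⟨p, rfl⟩ := exists_eq_lin_of_isHomogeneous_one hq
  have : g * lin p = p.1 • (g * X 0) + p.2 • (g * X 1) := by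
    rw [lin, smul_eq_C_mul, smul_eq_C_mul]; ring
  rw [this, map_add, map_smul, map_smul, h0, h1, smul_zero, smul_zero, add_zero]

/-- A real binary quadratic form with positive discriminant splits into two distinct real linear
factors. -/
lemma exists_annForm_mul_annForm {a b c : ℝ} (h : 0 < b ^ 2 - 4 * a * c) :
    ∃ (v w : ℝ × ℝ) (k : ℝ), v ≠ 0 ∧ w ≠ 0 ∧ cross v w ≠ 0 ∧
      annForm v * annForm w =
        C k * (C a * X 0 ^ 2 + C b * (X 0 * X 1) + C c * X 1 ^ 2) := by
  by_cases ha : a = 0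
  · subst ha
    have hb : b ≠ 0 := by rintro rfl; simp at h
    refine ⟨(-1, 0), (-c, b), 1, by simp, by simp [hb], by simp [cross, hb], ?_⟩
    simp only [annForm, lin, neg_neg, C_0, C_1]
    ring
  · set s := √(b ^ 2 - 4 * a * c) with hs
    have hs0 : s ≠ 0 := (Real.sqrt_pos.2 h).ne'
    have hs2 : s ^ 2 = b ^ 2 - 4 * a * c := Real.sq_sqrt h.le
    refine ⟨(-(b + s), 2 * a), (-(b - s), 2 * a), 4 * a, by simp [ha], by simp [ha], ?_, ?_⟩
    · simp only [cross]
      have : -(b + s) * (2 * a) - -(b - s) * (2 * a) = -4 * (a * s) := by ring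
      rw [this]
      exact mul_ne_zero (by norm_num) (mul_ne_zero ha hs0)
    · have hs3 := congrArg (C : ℝ → MvPolynomial (Fin 2) ℝ) hs2
      simp only [C_mul, C_sub, C_pow] at hs3
      simp only [annForm, lin, neg_neg, C_mul, C_add, C_sub]
      have h2 : (C 2 : MvPolynomial (Fin 2) ℝ) = 2 := map_ofNat C 2
      have h4 : (C 4 : MvPolynomial (Fin 2) ℝ) = 4 := map_ofNat C 4
      rw [h4] at hs3 ⊢
      rw [h2]
      linear_combination (-X 1 ^ 2) * hs3

lemma hessian_disc_pos {a₀ a₁ a₂ a₃ x y : ℝ} (hy : y ≠ 0)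
    (hre : a₃ * (x ^ 3 - 3 * x * y ^ 2) + 3 * a₂ * (x ^ 2 - y ^ 2) + 3 * a₁ * x + a₀ = 0)
    (him : a₃ * (3 * x ^ 2 - y ^ 2) + 6 * a₂ * x + 3 * a₁ = 0)
    (hne : ¬ (a₀ = 0 ∧ a₁ = 0 ∧ a₂ = 0 ∧ a₃ = 0)) :
    0 < (a₁ * a₂ - a₀ * a₃) ^ 2 - 4 * (a₀ * a₂ - a₁ ^ 2) * (a₁ * a₃ - a₂ ^ 2) := by
  obtain rfl : a₁ = -(a₃ * (3 * x ^ 2 - y ^ 2) + 6 * a₂ * x) / 3 := by linarith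
  obtain rfl : a₀ = -(a₃ * (x ^ 3 - 3 * x * y ^ 2) + 3 * a₂ * (x ^ 2 - y ^ 2) +
    3 * (-(a₃ * (3 * x ^ 2 - y ^ 2) + 6 * a₂ * x) / 3) * x) := by linarith
  have hpos : 0 < a₃ ^ 2 * y ^ 2 + 9 * (a₂ + x * a₃) ^ 2 := by
    by_cases h3 : a₃ = 0
    · subst h3
      have : a₂ ≠ 0 := by
        rintro rfl
        simp at hne
      simp only [mul_zero, add_zero]
      positivity
    · positivity
  have : 0 < y ^ 2 * (4 / 27) * (a₃ ^ 2 * y ^ 2 + 9 * (a₂ + x * a₃) ^ 2) ^ 2 := by positivity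
  refine this.trans_eq ?_
  ring

lemma exists_apolar_of_cubic {L : MvPolynomial (Fin 2) ℝ →ₗ[ℝ] ℝ} (hne : dehom (genForm 3 L) ≠ 0)
    {z : ℂ} (hz : z.im ≠ 0) (h0 : Polynomial.aeval z (dehom (genForm 3 L)) = 0) :
    ∃ v : Fin 2 → ℝ × ℝ, (∀ i, v i ≠ 0) ∧ (∀ i j, i ≠ j → cross (v i) (v j) ≠ 0) ∧
      ∀ q : MvPolynomial (Fin 2) ℝ, q.IsHomogeneous 1 → L ((∏ i, annForm (v i)) * q) = 0 := by
  obtain ⟨a₀, ha₀⟩ : ∃ a, L (X 1 ^ 3) = a := ⟨_, rfl⟩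
  obtain ⟨a₁, ha₁⟩ : ∃ a, L (X 0 * X 1 ^ 2) = a := ⟨_, rfl⟩
  obtain ⟨a₂, ha₂⟩ : ∃ a, L (X 0 ^ 2 * X 1) = a := ⟨_, rfl⟩
  obtain ⟨a₃, ha₃⟩ : ∃ a, L (X 0 ^ 3) = a := ⟨_, rfl⟩
  have hP : dehom (genForm 3 L) = Polynomial.C a₃ * Polynomial.X ^ 3 +
      3 * Polynomial.C a₂ * Polynomial.X ^ 2 + 3 * Polynomial.C a₁ * Polynomial.X +
      Polynomial.C a₀ := by
    rw [← ha₀, ← ha₁, ← ha₂, ← ha₃]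
    simp only [dehom_genForm_succ, genForm_zero, dehom_C, contract_apply, mul_one]
    ring_nf
  rw [hP] at h0 hne
  have hz' : z = z.re + z.im * Complex.I := (Complex.re_add_im z).symm
  have hexp : ∀ x y : ℝ, (a₃ : ℂ) * (x + y * Complex.I) ^ 3 + 3 * a₂ * (x + y * Complex.I) ^ 2 +
      3 * a₁ * (x + y * Complex.I) + a₀ =
      ((a₃ * (x ^ 3 - 3 * x * y ^ 2) + 3 * a₂ * (x ^ 2 - y ^ 2) + 3 * a₁ * x + a₀ : ℝ) : ℂ) +
      ((y * (a₃ * (3 * x ^ 2 - y ^ 2) + 6 * a₂ * x + 3 * a₁) : ℝ) : ℂ) * Complex.I := by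
    intro x y
    push_cast
    linear_combination (a₃ * (3 * x * y ^ 2 + y ^ 3 * Complex.I) + 3 * a₂ * y ^ 2 : ℂ) *
      Complex.I_sq
  have heq : (a₃ : ℂ) * z ^ 3 + 3 * a₂ * z ^ 2 + 3 * a₁ * z + a₀ = 0 := by
    have h3 : Polynomial.aeval z (3 : Polynomial ℝ) = 3 := map_ofNat _ 3
    simpa [h3] using h0
  rw [hz', hexp] at heq
  have hre := congrArg Complex.re heq
  have him := congrArg Complex.im heq
  rw [Complex.add_re, Complex.re_ofReal_mul, Complex.I_re, Complex.ofReal_re] at hre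
  rw [Complex.add_im, Complex.im_ofReal_mul, Complex.I_im, Complex.ofReal_im] at him
  have hdisc := hessian_disc_pos (a₀ := a₀) (a₁ := a₁) (a₂ := a₂) (a₃ := a₃) hz
    (by simpa using hre) (by simpa [hz] using him) (by
      rintro ⟨rfl, rfl, rfl, rfl⟩
      simp at hne)
  obtain ⟨v, w, k, hv, hw, hvw, e⟩ := exists_annForm_mul_annForm hdisc
  refine ⟨![v, w], ?_, ?_, fun q hq => ?_⟩
  · intro i; fin_cases i <;> simpa
  · have hwv : cross w v ≠ 0 := by
      contrapose! hvw
      simp only [cross] at hvw ⊢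
      linarith
    intro i j hij
    fin_cases i <;> fin_cases j
    exacts [absurd rfl hij, hvw, hwv, absurd rfl hij]
  · rw [Fin.prod_univ_two]
    simp only [Matrix.cons_val_zero, Matrix.cons_val_one]
    refine apply_mul_eq_zero_of_isHomogeneous_one ?_ ?_ hq
    · have : annForm v * annForm w * X 0 = (k * (a₀ * a₂ - a₁ ^ 2)) • X 0 ^ 3 +
          (k * (a₁ * a₂ - a₀ * a₃)) • (X 0 ^ 2 * X 1) +
          (k * (a₁ * a₃ - a₂ ^ 2)) • (X 0 * X 1 ^ 2) := by
        rw [e]; simp only [smul_eq_C_mul, C_mul]; ring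
      rw [this]
      simp only [map_add, map_smul, ha₁, ha₂, ha₃, smul_eq_mul]
      ring
    · have : annForm v * annForm w * X 1 = (k * (a₀ * a₂ - a₁ ^ 2)) • (X 0 ^ 2 * X 1) +
          (k * (a₁ * a₂ - a₀ * a₃)) • (X 0 * X 1 ^ 2) +
          (k * (a₁ * a₃ - a₂ ^ 2)) • X 1 ^ 3 := by
        rw [e]; simp only [smul_eq_C_mul, C_mul]; ring
      rw [this]
      simp only [map_add, map_smul, ha₁, ha₂, ha₀, smul_eq_mul]
      ring

end CubicForms

section Perturbation

lemma exists_root_of_mul_neg {φ : ℝ → ℝ} (hφ : Continuous φ) {a b : ℝ} (hab : a < b)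
    (h : φ a * φ b < 0) : ∃ t, a < t ∧ t < b ∧ φ t = 0 := by
  rcases mul_neg_iff.1 h with ⟨ha, hb⟩ | ⟨ha, hb⟩
  · obtain ⟨t, ht, h0⟩ := intermediate_value_Ioo' hab.le hφ.continuousOn ⟨hb, ha⟩
    exact ⟨t, ht.1, ht.2, h0⟩
  · obtain ⟨t, ht, h0⟩ := intermediate_value_Ioo hab.le hφ.continuousOn ⟨ha, hb⟩
    exact ⟨t, ht.1, ht.2, h0⟩

lemma continuous_evalAt (g : MvPolynomial (Fin 2) ℝ) : Continuous fun v : ℝ × ℝ => evalAt v g := by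
  simp only [evalAt_apply]
  refine (MvPolynomial.continuous_eval g).comp (continuous_pi fun i => ?_)
  fin_cases i
  exacts [continuous_fst, continuous_snd]

lemma evalAt_smul {n : ℕ} {g : MvPolynomial (Fin 2) ℝ} (hg : g.IsHomogeneous n) (c : ℝ)
    (v : ℝ × ℝ) : evalAt (c • v) g = c ^ n * evalAt v g := by
  have h := aeval_mul_of_isHomogeneous hg c ![v.1, v.2]
  rw [aeval_eq_eval, aeval_eq_eval] at h
  rw [evalAt_apply, evalAt_apply]
  convert h using 3
  funext i
  fin_cases i <;> simp

/-- The line through `v` orthogonal to `v`. -/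
def normalLine (v : ℝ × ℝ) (t : ℝ) : ℝ × ℝ := (v.1 - t * v.2, v.2 + t * v.1)

lemma normalLine_zero (v : ℝ × ℝ) : normalLine v 0 = v := by simp [normalLine]

lemma continuous_normalLine (v : ℝ × ℝ) : Continuous (normalLine v) := by
  unfold normalLine; fun_prop

lemma cross_normalLine (v : ℝ × ℝ) (s t : ℝ) :
    cross (normalLine v s) (normalLine v t) = (t - s) * (v.1 ^ 2 + v.2 ^ 2) := by
  simp only [cross, normalLine]; ring

lemma sq_add_sq_pos {v : ℝ × ℝ} (hv : v ≠ 0) : 0 < v.1 ^ 2 + v.2 ^ 2 := by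
  have hv' : v.1 ≠ 0 ∨ v.2 ≠ 0 := by
    by_contra! hc
    exact hv (Prod.ext hc.1 hc.2)
  rcases hv' with h | h <;> positivity

lemma cross_swap (v w : ℝ × ℝ) : cross w v = -cross v w := by
  simp only [cross]; ring

lemma exists_pos_forall_cross_mul_cross_pos {r : ℕ} {v : Fin r → ℝ × ℝ}
    (hvw : ∀ i j, i ≠ j → cross (v i) (v j) ≠ 0) :
    ∃ δ > 0, ∀ i j, i ≠ j → ∀ s t : ℝ, |s| ≤ δ → |t| ≤ δ →
      0 < cross (normalLine (v i) s) (normalLine (v j) t) * cross (v i) (v j) := by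
  have h : ∀ᶠ x : ℝ × ℝ in nhds 0, ∀ i j, i ≠ j →
      0 < cross (normalLine (v i) x.1) (normalLine (v j) x.2) * cross (v i) (v j) := by
    refine Filter.eventually_all.2 fun i => Filter.eventually_all.2 fun j => ?_
    by_cases hij : i = j
    · simp [hij]
    have hc : Continuous fun x : ℝ × ℝ =>
        cross (normalLine (v i) x.1) (normalLine (v j) x.2) * cross (v i) (v j) := by
      unfold cross normalLine; fun_prop
    have h0 : 0 < cross (normalLine (v i) (0 : ℝ × ℝ).1) (normalLine (v j) (0 : ℝ × ℝ).2) *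
        cross (v i) (v j) := by
      simp only [Prod.fst_zero, Prod.snd_zero, normalLine_zero]
      exact mul_self_pos.2 (hvw i j hij)
    filter_upwards [hc.continuousAt.eventually_const_lt h0] with x hx _ using hx
  obtain ⟨δ, hδ, h⟩ := Metric.nhds_basis_closedBall.eventually_iff.1 h
  refine ⟨δ, hδ, fun i j hij s t hs ht => h (x := (s, t)) ?_ i j hij⟩
  simpa [Prod.dist_eq, Prod.norm_def] using ⟨hs, ht⟩

/-- A product of distinct lines with one of them doubled can be perturbed, in the direction of any
form not vanishing on the double line, to a form with distinct real lines. -/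
lemma exists_perturbation {r : ℕ} {v : Fin r → ℝ × ℝ} (hv : ∀ i, v i ≠ 0)
    (hvw : ∀ i j, i ≠ j → cross (v i) (v j) ≠ 0) (i₀ : Fin r) {H : MvPolynomial (Fin 2) ℝ}
    (hH : evalAt (v i₀) H ≠ 0) :
    ∃ (ε : ℝ) (u : Fin (r + 1) → ℝ × ℝ), ε ≠ 0 ∧ (∀ i, u i ≠ 0) ∧
      (∀ i j, i ≠ j → cross (u i) (u j) ≠ 0) ∧
      ∀ i, evalAt (u i) (annForm (v i₀) * (∏ i, annForm (v i)) + ε • H) = 0 := by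
  obtain ⟨δ, hδ, hcr⟩ := exists_pos_forall_cross_mul_cross_pos hvw
  set G := annForm (v i₀) * ∏ i, annForm (v i) with hG
  have hGe : ∀ i x, evalAt x G = cross x (v i₀) *
      (cross x (v i) * ∏ j ∈ Finset.univ.erase i, cross x (v j)) := by
    intro i x
    rw [hG, evalAt_mul, evalAt_prod, evalAt_annForm,
      Finset.mul_prod_erase _ (fun j => cross x (v j)) (Finset.mem_univ i)]
    simp only [evalAt_annForm]
  have hcr0 : ∀ i j, i ≠ j → ∀ s, |s| ≤ δ →
      0 < cross (normalLine (v i) s) (v j) * cross (v i) (v j) := fun i j hij s hs => by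
    simpa only [normalLine_zero] using hcr i j hij s 0 hs (by simpa using hδ.le)
  have hself : ∀ i s, cross (normalLine (v i) s) (v i) = -s * ((v i).1 ^ 2 + (v i).2 ^ 2) := by
    intro i s
    simpa only [normalLine_zero, zero_sub] using cross_normalLine (v i) s 0
  set A : Fin r → ℝ := fun i => ∏ j ∈ Finset.univ.erase i, cross (v i) (v j) with hA
  have hprod : ∀ i s, |s| ≤ δ →
      0 < (∏ j ∈ Finset.univ.erase i, cross (normalLine (v i) s) (v j)) * A i := by
    intro i s hs
    rw [hA, ← Finset.prod_mul_distrib]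
    exact Finset.prod_pos fun j hj => hcr0 i j (Finset.ne_of_mem_erase hj).symm s hs
  have hδ1 : |δ| ≤ δ := (abs_of_pos hδ).le
  have hδ2 : |-δ| ≤ δ := by rw [abs_neg]; exact hδ1

  have hsimple : ∀ i, i ≠ i₀ →
      evalAt (normalLine (v i) (-δ)) G * evalAt (normalLine (v i) δ) G < 0 := by
    intro i hi
    rw [hGe i, hGe i, hself, hself]
    have h1 := hcr0 i i₀ hi _ hδ2
    have h2 := hcr0 i i₀ hi _ hδ1
    have h3 := hprod i _ hδ2
    have h4 := hprod i _ hδ1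
    have h5 := sq_add_sq_pos (hv i)
    have h6 := mul_pos (mul_pos h1 h2) (mul_pos h3 h4)
    set c₁ := cross (normalLine (v i) (-δ)) (v i₀)
    set c₂ := cross (normalLine (v i) δ) (v i₀)
    set p₁ := ∏ j ∈ Finset.univ.erase i, cross (normalLine (v i) (-δ)) (v j)
    set p₂ := ∏ j ∈ Finset.univ.erase i, cross (normalLine (v i) δ) (v j)
    set N := (v i).1 ^ 2 + (v i).2 ^ 2
    have h7 : 0 < (cross (v i) (v i₀) * A i) ^ 2 * (c₁ * c₂ * p₁ * p₂) := by
      refine h6.trans_eq ?_; ring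
    have h8 := pos_of_mul_pos_right h7 (sq_nonneg _)
    have h9 : 0 < (δ * N) ^ 2 * (c₁ * c₂ * p₁ * p₂) := by positivity
    refine lt_of_eq_of_lt ?_ (neg_neg_of_pos h9)
    ring
  have hdouble : ∀ s, |s| ≤ δ → s ≠ 0 → 0 < evalAt (normalLine (v i₀) s) G * A i₀ := by
    intro s hs hs0
    rw [hGe i₀, hself]
    have h1 := hprod i₀ s hs
    have h2 := sq_add_sq_pos (hv i₀)
    set N := (v i₀).1 ^ 2 + (v i₀).2 ^ 2
    have h3 : 0 < (s * N) ^ 2 * ((∏ j ∈ Finset.univ.erase i₀, cross (normalLine (v i₀) s) (v j)) *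
      A i₀) := by positivity
    refine h3.trans_eq ?_; ring
  have hG0 : evalAt (v i₀) G = 0 := by
    rw [hGe i₀]; simp [cross]
  have hA0 : A i₀ ≠ 0 := fun h => by simpa [h] using hdouble δ hδ1 hδ.ne'
  set k : ℝ := -(evalAt (v i₀) H * A i₀) with hk
  have hk0 : k ≠ 0 := neg_ne_zero.2 (mul_ne_zero hH hA0)
  have hFc : ∀ x, Continuous fun ε : ℝ => evalAt x (G + (ε * k) • H) := fun x => by
    simp only [map_add, map_smul, smul_eq_mul]; fun_prop
  have hF0 : ∀ x, evalAt x (G + ((0 : ℝ) * k) • H) = evalAt x G := fun x => by simp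
  have ev1 : ∀ᶠ ε : ℝ in nhds 0, ∀ i, i ≠ i₀ →
      evalAt (normalLine (v i) (-δ)) (G + (ε * k) • H) *
        evalAt (normalLine (v i) δ) (G + (ε * k) • H) < 0 := by
    refine Filter.eventually_all.2 fun i => ?_
    by_cases hi : i = i₀
    · simp [hi]
    have := ((hFc (normalLine (v i) (-δ))).mul (hFc (normalLine (v i) δ))).continuousAt
      (x := 0) |>.eventually_lt_const (u := 0)
      (by simpa only [Pi.mul_apply, hF0] using hsimple i hi)
    filter_upwards [this] with ε hε _ using hε
  have ev2 : ∀ s, |s| ≤ δ → s ≠ 0 → ∀ᶠ ε : ℝ in nhds 0,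
      0 < evalAt (normalLine (v i₀) s) (G + (ε * k) • H) * A i₀ := by
    intro s hs hs0
    exact ((hFc (normalLine (v i₀) s)).mul_const (A i₀)).continuousAt
      (x := 0) |>.eventually_const_lt (u := 0) (by simpa only [hF0] using hdouble s hs hs0)
  have ev : ∀ᶠ ε : ℝ in nhdsWithin 0 (Set.Ioi 0), _ :=
    ((ev1.and ((ev2 δ hδ1 hδ.ne').and (ev2 (-δ) hδ2 (neg_ne_zero.2 hδ.ne')))).filter_mono
      nhdsWithin_le_nhds).and (self_mem_nhdsWithin (s := Set.Ioi (0 : ℝ)))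
  obtain ⟨ε, ⟨hε1, hε2, hε3⟩, hε⟩ := ev.exists
  set F := G + (ε * k) • H with hF
  have hε' : (0 : ℝ) < ε := hε
  have hcenter : evalAt (normalLine (v i₀) 0) F * A i₀ < 0 := by
    rw [normalLine_zero, hF, map_add, hG0, map_smul, smul_eq_mul, hk, zero_add]
    have : 0 < ε * (evalAt (v i₀) H * A i₀) ^ 2 := by
      have := mul_ne_zero hH hA0
      positivity
    refine lt_of_eq_of_lt ?_ (neg_neg_of_pos this); ring
  have hopp : ∀ x y : ℝ, 0 < x * A i₀ → y * A i₀ < 0 → x * y < 0 := by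
    intro x y hx hy
    have h1 := mul_neg_of_pos_of_neg hx hy
    have h2 : A i₀ ^ 2 * (x * y) < 0 := lt_of_eq_of_lt (by ring) h1
    exact (pos_iff_neg_of_mul_neg h2).1 (by positivity)
  have hFline : ∀ i, Continuous fun t => evalAt (normalLine (v i) t) F := fun i =>
    (continuous_evalAt F).comp (continuous_normalLine (v i))
  obtain ⟨t', ht'1, ht'2, ht'⟩ := exists_root_of_mul_neg (hFline i₀) (neg_lt_zero.2 hδ)
    (hopp _ _ hε3 hcenter)
  have hroots : ∀ i, ∃ t, |t| ≤ δ ∧ (i = i₀ → 0 < t) ∧ evalAt (normalLine (v i) t) F = 0 := by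
    intro i
    by_cases hi : i = i₀
    · subst hi
      obtain ⟨t, h1, h2, h3⟩ := exists_root_of_mul_neg (hFline i) hδ
        (by rw [mul_comm]; exact hopp _ _ hε2 hcenter)
      exact ⟨t, abs_le.2 ⟨by linarith, h2.le⟩, fun _ => h1, h3⟩
    · obtain ⟨t, h1, h2, h3⟩ := exists_root_of_mul_neg (hFline i) (by linarith) (hε1 i hi)
      exact ⟨t, abs_le.2 ⟨h1.le, h2.le⟩, fun h => absurd h hi, h3⟩
  choose t ht htpos htroot using hroots
  have hne : ∀ (v : ℝ × ℝ) s, v ≠ 0 → normalLine v s ≠ 0 := by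
    intro v s hv h
    have h1 := cross_normalLine v s (s + 1)
    rw [h] at h1
    have := sq_add_sq_pos hv
    simp [cross] at h1
    linarith
  have hzs : ∀ j, cross (normalLine (v i₀) t') (normalLine (v j) (t j)) ≠ 0 := by
    intro j
    by_cases hj : j = i₀
    · subst hj
      rw [cross_normalLine]
      have := htpos j rfl
      exact mul_ne_zero (by linarith) (sq_add_sq_pos (hv j)).ne'
    · exact left_ne_zero_of_mul (hcr i₀ j (Ne.symm hj) t' (t j)
        (abs_le.2 ⟨ht'1.le, by linarith⟩) (ht j)).ne'
  refine ⟨ε * k, Fin.cons (normalLine (v i₀) t') fun i => normalLine (v i) (t i),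
    mul_ne_zero hε'.ne' hk0, ?_, ?_, ?_⟩
  · refine Fin.cases ?_ fun j => ?_
    · exact hne _ _ (hv _)
    · exact hne _ _ (hv _)
  · refine Fin.cases (Fin.cases (fun h => absurd rfl h) fun j _ => ?_)
      fun i => Fin.cases (fun _ => ?_) fun j hij => ?_
    · exact hzs j
    · rw [cross_swap]; exact neg_ne_zero.2 (hzs i)
    · exact left_ne_zero_of_mul (hcr i j (fun h => hij (congrArg _ h)) _ _ (ht i) (ht j)).ne'
  · refine Fin.cases ?_ fun j => ?_
    · exact ht'
    · exact htroot j

end Perturbation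

section Apolarity

/-- `P` has a nonreal root. -/
def HasNonrealRoot (P : Polynomial ℝ) : Prop := ∃ z : ℂ, z.im ≠ 0 ∧ Polynomial.aeval z P = 0

lemma exists_apolar_evalAt_ne_zero {n : ℕ} {L : MvPolynomial (Fin 2) ℝ →ₗ[ℝ] ℝ} {v : ℝ × ℝ}
    (hv : v ≠ 0) (hne : dehom (genForm (1 + n) (contract (annForm v) L)) ≠ 0)
    (hz : HasNonrealRoot (dehom (genForm (1 + n) (contract (annForm v) L)))) :
    ∃ H : MvPolynomial (Fin 2) ℝ, H.IsHomogeneous (1 + n) ∧ L (H * X 0) = 0 ∧ L (H * X 1) = 0 ∧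
      evalAt v H ≠ 0 := by
  by_contra! hcon
  obtain ⟨c, hc⟩ := exists_eq_sum_of_forall_isHomogeneous (1 + n)
    (fun i : Fin 2 => contract (X i) L) (evalAt v) fun g hg h =>
      hcon g hg (by rw [mul_comm]; exact h 0) (by rw [mul_comm]; exact h 1)
  have hc' : ∀ g : MvPolynomial (Fin 2) ℝ, g.IsHomogeneous (1 + n) →
      evalAt v g = L (annForm (-c 1, c 0) * g) := by
    intro g hg
    have h := contract_lin (c 0, c 1) L
    rw [lin_eq_annForm] at h
    rw [hc g hg, Fin.sum_univ_two, ← contract_apply, h]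
    rfl
  have hu : ((-c 1, c 0) : ℝ × ℝ) ≠ 0 := by
    intro h
    have h1 := hc' (lin v ^ (1 + n)) (by simpa using (isHomogeneous_lin v).pow (1 + n))
    have h2 : annForm ((0 : ℝ), (0 : ℝ)) = 0 := by simp [annForm, lin]
    rw [h, ← Prod.mk_zero_zero, h2, zero_mul, map_zero, evalAt_apply, map_pow, ← evalAt_apply,
      evalAt_lin] at h1
    have h3 := sq_add_sq_pos hv
    have h4 := pow_eq_zero_iff (by lia) |>.1 h1
    nlinarith
  obtain ⟨k, hk⟩ := exists_eq_sum_evalAt (fun _ : Fin 1 => ((-c 1, c 0) : ℝ × ℝ)) (fun _ => hu)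
    (fun i j hij => absurd (Subsingleton.elim i j) hij) (contract (annForm v) L) (k := n)
    fun q hq => by
      rw [Fin.prod_univ_one, contract_apply, mul_left_comm,
        ← hc' _ ((isHomogeneous_annForm v).mul hq), evalAt_mul, evalAt_annForm]
      simp [cross]
  rw [genForm_eq_sum hk, Fin.sum_univ_one, map_mul, map_pow, dehom_C, dehom_lin] at hz hne
  obtain ⟨z, hz, h0⟩ := hz
  have hk0 : k 0 ≠ 0 := by
    intro h
    simp [h] at hne
  have h1 : (-(c 1) : ℂ) * z + c 0 = 0 := by
    rw [map_mul, map_pow, Polynomial.aeval_C] at h0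
    have h2 := (mul_eq_zero.1 h0).resolve_left (by simpa using hk0)
    have h3 := (pow_eq_zero_iff (by lia)).1 h2
    simpa using h3
  have h2 : c 1 = 0 := by
    have := congrArg Complex.im h1
    simpa [hz] using this
  have h3 : c 0 = 0 := by
    rw [h2] at h1
    simpa using h1
  exact hu (by simp [h2, h3])

/-- A form of degree `m + 3` with a nonreal root is apolar to a form of degree `m + 2` with
distinct real roots. -/
theorem exists_apolar (m : ℕ) {L : MvPolynomial (Fin 2) ℝ →ₗ[ℝ] ℝ}
    (hne : dehom (genForm (m + 3) L) ≠ 0) (hz : HasNonrealRoot (dehom (genForm (m + 3) L))) :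
    ∃ v : Fin (m + 2) → ℝ × ℝ, (∀ i, v i ≠ 0) ∧ (∀ i j, i ≠ j → cross (v i) (v j) ≠ 0) ∧
      ∀ q : MvPolynomial (Fin 2) ℝ, q.IsHomogeneous 1 → L ((∏ i, annForm (v i)) * q) = 0 := by
  induction m generalizing L with
  | zero =>
    obtain ⟨z, hz, h0⟩ := hz
    exact exists_apolar_of_cubic hne hz h0
  | succ m ih =>
    obtain ⟨z, hz, h0⟩ := hz
    rw [show m + 1 + 3 = m + 3 + 1 from rfl, dehom_genForm_succ] at h0 hne
    obtain ⟨a, b, hab, w, hw, hw0⟩ := exists_nonreal_root_pencil (N := m + 3) (by lia)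
      (q₁ := dehom (genForm (m + 3) (contract (X 0) L)))
      (q₂ := dehom (genForm (m + 3) (contract (X 1) L)))
      (natDegree_dehom_le (isHomogeneous_genForm _ _))
      (by
        rw [show m + 3 = m + 2 + 1 from rfl, derivative_dehom_genForm, derivative_dehom_genForm,
          dehom_genForm_succ (m + 2) (contract (X 0) L), contract_comm (X 0) (X 1)]
        push_cast
        ring) hz (by simpa using h0) (by
        by_contra! hc
        simp [hc.1, hc.2] at hne)
    have hcomb : dehom (genForm (m + 3) (contract (annForm (-b, a)) L)) =
        Polynomial.C a * dehom (genForm (m + 3) (contract (X 0) L)) +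
          Polynomial.C b * dehom (genForm (m + 3) (contract (X 1) L)) := by
      have h := contract_lin (a, b) L
      rw [lin_eq_annForm] at h
      rw [h]
      simp only [map_add, map_smul, Polynomial.smul_eq_C_mul]
    rw [← hcomb] at hab hw0
    set u : ℝ × ℝ := (-b, a) with hu
    have hu0 : u ≠ 0 := by
      intro h
      have h2 : annForm ((0 : ℝ), (0 : ℝ)) = 0 := by simp [annForm, lin]
      have h3 : contract (annForm u) L = 0 := by
        refine LinearMap.ext fun g => ?_
        rw [h, ← Prod.mk_zero_zero, h2, contract_apply, zero_mul, map_zero, LinearMap.zero_apply]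
      rw [h3] at hab
      simp at hab
    obtain ⟨v, hv, hvw, hann⟩ := ih hab ⟨w, hw, hw0⟩
    by_cases hcase : ∀ i, cross u (v i) ≠ 0
    · refine ⟨Fin.cons u v, Fin.cases hu0 hv, ?_, fun q hq => ?_⟩
      · refine Fin.cases (Fin.cases (fun h => absurd rfl h) fun j _ => hcase j)
          fun i => Fin.cases (fun _ => ?_) fun j hij => ?_
        · change cross (v i) u ≠ 0
          rw [cross_swap]; exact neg_ne_zero.2 (hcase i)
        · exact hvw i j fun h => hij (congrArg _ h)
      · rw [Fin.prod_univ_succ, Fin.cons_zero, mul_assoc]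
        simpa only [Fin.cons_succ, contract_apply] using hann q hq
    · push Not at hcase
      obtain ⟨i₀, hi₀⟩ := hcase
      obtain ⟨k, hk⟩ := exists_smul_of_cross_eq_zero hu0 hi₀
      have hk0 : k ≠ 0 := by
        rintro rfl
        exact hv i₀ (by rw [hk, zero_smul])
      obtain ⟨H, hH, hHX, hHY, hHu⟩ := exists_apolar_evalAt_ne_zero (n := m + 2) hu0
        (by rwa [add_comm 1]) ⟨w, hw, by rwa [add_comm 1]⟩
      obtain ⟨ε, t, hε, ht, htt, hroot⟩ := exists_perturbation hv hvw i₀ (H := H) (by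
        rw [hk, evalAt_smul hH]
        exact mul_ne_zero (pow_ne_zero _ hk0) hHu)
      have hFhom : (annForm (v i₀) * (∏ i, annForm (v i)) + ε • H).IsHomogeneous
          (m + 2 + 1 + 0) := by
        rw [add_zero]
        refine IsHomogeneous.add ?_ ?_
        · rw [add_comm (m + 2)]
          refine (isHomogeneous_annForm _).mul ?_
          simpa using isHomogeneous_prod Finset.univ _ fun i => isHomogeneous_annForm (v i)
        · rw [smul_eq_C_mul, add_comm (m + 2)]
          exact hH.C_mul ε
      obtain ⟨q, hq, e⟩ := exists_eq_prod_annForm_mul t ht htt hFhom hroot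
      rw [← totalDegree_zero_iff_isHomogeneous, totalDegree_eq_zero_iff_eq_C] at hq
      have hF0 : evalAt (v i₀) (annForm (v i₀) * (∏ i, annForm (v i)) + ε • H) ≠ 0 := by
        rw [map_add, evalAt_mul, evalAt_annForm, map_smul, hk, evalAt_smul hH]
        simp only [cross, sub_self, zero_mul, zero_add]
        exact smul_ne_zero hε (mul_ne_zero (pow_ne_zero _ hk0) hHu)
      have hq0 : coeff 0 q ≠ 0 := by
        intro h
        rw [hq, h, C_0, mul_zero] at e
        exact hF0 (by rw [e, map_zero])
      refine ⟨t, ht, htt, fun p hp => ?_⟩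
      have hLF : L ((annForm (v i₀) * (∏ i, annForm (v i)) + ε • H) * p) = 0 := by
        have h1 := hann p hp
        rw [contract_apply] at h1
        have h2 : annForm (v i₀) * (∏ i, annForm (v i)) * p =
            k • (annForm u * ((∏ i, annForm (v i)) * p)) := by
          conv_lhs => rw [hk, annForm_smul]
          rw [smul_eq_C_mul]
          ring
        rw [add_mul, map_add, h2, map_smul, h1, smul_mul_assoc, map_smul,
          apply_mul_eq_zero_of_isHomogeneous_one hHX hHY hp, smul_zero, smul_zero, add_zero]
      rw [e, hq] at hLF
      have h3 : (∏ i, annForm (t i)) * C (coeff 0 q) * p =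
          coeff 0 q • ((∏ i, annForm (t i)) * p) := by
        rw [smul_eq_C_mul]; ring
      rw [h3, map_smul, smul_eq_mul] at hLF
      exact (mul_eq_zero.1 hLF).resolve_left hq0

end Apolarity

section UpperBound

lemma continuous_apply_prod_lin (n : ℕ) (L : MvPolynomial (Fin 2) ℝ →ₗ[ℝ] ℝ) :
    Continuous fun t : Fin n → ℝ => L (∏ i, lin (t i, 1)) := by
  induction n generalizing L with
  | zero => simpa using continuous_const
  | succ n ih =>
    have h : ∀ t : Fin (n + 1) → ℝ, L (∏ i, lin (t i, 1)) =
        t 0 * contract (X 0) L (∏ i : Fin n, lin (t i.succ, 1)) +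
          contract (X 1) L (∏ i : Fin n, lin (t i.succ, 1)) := by
      intro t
      rw [Fin.prod_univ_succ, ← contract_apply, contract_lin]
      simp
    simp only [h]
    have hs : Continuous fun t : Fin (n + 1) → ℝ => fun i : Fin n => t i.succ := by fun_prop
    exact ((continuous_apply 0).mul ((ih (contract (X 0) L)).comp hs)).add
      ((ih (contract (X 1) L)).comp hs)

lemma apply_lin_pow (n : ℕ) (L : MvPolynomial (Fin 2) ℝ →ₗ[ℝ] ℝ) (s : ℝ) :
    L (lin (s, 1) ^ n) = (dehom (genForm n L)).eval s := by
  induction n generalizing L with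
  | zero => simp [genForm_zero]
  | succ n ih =>
    rw [pow_succ', ← contract_apply, contract_lin, dehom_genForm_succ, Polynomial.eval_add,
      Polynomial.eval_mul, Polynomial.eval_X, ← ih, ← ih]
    simp

lemma exists_neg_pos_of_simple_root {P : Polynomial ℝ} {r : ℝ} (h : P.eval r = 0)
    (h' : P.derivative.eval r ≠ 0) : (∃ a, P.eval a < 0) ∧ ∃ b, 0 < P.eval b := by
  constructor
  · by_contra! hc
    have hm : IsLocalMin (fun x => P.eval x) r := Filter.Eventually.of_forall fun x => by
      simpa only [h] using hc x
    exact h' (hm.hasDerivAt_eq_zero (P.hasDerivAt r))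
  · by_contra! hc
    have hm : IsLocalMax (fun x => P.eval x) r := Filter.Eventually.of_forall fun x => by
      simpa only [h] using hc x
    exact h' (hm.hasDerivAt_eq_zero (P.hasDerivAt r))

lemma HasDistinctRealRoots.exists_neg_pos {n : ℕ} (hn : 2 ≤ n) {f : MvPolynomial (Fin 2) ℝ}
    (h : HasDistinctRealRoots f n) :
    (∃ a, (dehom f).eval a < 0) ∧ ∃ b, 0 < (dehom f).eval b := by
  obtain ⟨c, l, hc, -, hll, rfl⟩ := h
  obtain ⟨i, hi⟩ : ∃ i, (l i).1 ≠ 0 := by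
    by_contra! h0
    exact hll ⟨0, by lia⟩ ⟨1, by lia⟩ (by simp) (by simp [h0])
  set Q := Polynomial.C c * ∏ j ∈ Finset.univ.erase i, dehom (lin (l j)) with hQ
  have hP : dehom (C c * ∏ i, lin (l i)) =
      (Polynomial.C (l i).1 * Polynomial.X + Polynomial.C (l i).2) * Q := by
    rw [map_mul, dehom_C, map_prod, ← Finset.mul_prod_erase _ _ (Finset.mem_univ i), hQ,
      dehom_lin (l i)]
    ring
  have hr : (l i).1 * (-(l i).2 / (l i).1) + (l i).2 = 0 := by field_simp; ring
  refine exists_neg_pos_of_simple_root (r := -(l i).2 / (l i).1) ?_ ?_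
  · rw [hP, Polynomial.eval_mul]
    simp only [Polynomial.eval_add, Polynomial.eval_mul, Polynomial.eval_C, Polynomial.eval_X]
    rw [hr, zero_mul]
  · rw [hP, Polynomial.derivative_mul]
    simp only [Polynomial.eval_add, Polynomial.eval_mul, Polynomial.eval_C, Polynomial.eval_X,
      Polynomial.derivative_add, Polynomial.derivative_C_mul, Polynomial.derivative_X,
      Polynomial.derivative_C, mul_one, add_zero]
    rw [hr, zero_mul, add_zero, hQ, Polynomial.eval_mul, Polynomial.eval_C, Polynomial.eval_prod]
    refine mul_ne_zero hi (mul_ne_zero hc (Finset.prod_ne_zero_iff.2 fun j hj => ?_))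
    have h1 := hll i j (Finset.ne_of_mem_erase hj).symm
    simp only [dehom_lin, Polynomial.eval_add, Polynomial.eval_mul, Polynomial.eval_C,
      Polynomial.eval_X]
    contrapose! h1
    field_simp at h1
    linarith

/-- A form of degree `n` with `n` distinct real roots is a sum of `n` powers of real linear
forms. -/
lemma HasDistinctRealRoots.waringDecomp {n : ℕ} (hn : 2 ≤ n) {f : MvPolynomial (Fin 2) ℝ}
    (hf : f.IsHomogeneous n) (h : HasDistinctRealRoots f n) : WaringDecomp f n n := by
  obtain ⟨⟨a, ha⟩, b, hb⟩ := h.exists_neg_pos hn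
  obtain ⟨L, rfl⟩ := exists_genForm_eq hf
  set φ : ℝ → ℝ → ℝ := fun ε s => L (∏ i : Fin n, lin (s + ε * i, 1)) with hφ
  have h0 : ∀ s, φ 0 s = (dehom (genForm n L)).eval s := fun s => by
    simp [hφ, ← apply_lin_pow]
  have hc1 : ∀ s, Continuous fun ε => φ ε s := fun s =>
    (continuous_apply_prod_lin n L).comp (by fun_prop : Continuous fun ε : ℝ =>
      fun i : Fin n => s + ε * (i : ℝ))
  have hc2 : ∀ ε, Continuous (φ ε) := fun ε =>
    (continuous_apply_prod_lin n L).comp (by fun_prop : Continuous fun s : ℝ =>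
      fun i : Fin n => s + ε * (i : ℝ))
  have ev : ∀ᶠ ε : ℝ in nhdsWithin 0 (Set.Ioi 0), _ :=
    ((((hc1 a).continuousAt (x := 0)).eventually_lt_const (u := 0) (by simpa only [h0])).and
      (((hc1 b).continuousAt (x := 0)).eventually_const_lt (u := 0)
        (by simpa only [h0]))).filter_mono nhdsWithin_le_nhds |>.and (self_mem_nhdsWithin (s := Set.Ioi (0 : ℝ)))
  obtain ⟨ε, ⟨hε1, hε2⟩, hε⟩ := ev.exists
  have hε' : (0 : ℝ) < ε := hε
  obtain ⟨s, hs⟩ := mem_range_of_exists_le_of_exists_ge (hc2 ε) ⟨a, hε1.le⟩ ⟨b, hε2.le⟩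
  have hann : ∀ i : Fin n, annForm (-1, s + ε * i) = lin (s + ε * i, 1) := fun i => by
    simp [annForm]
  refine waringDecomp_genForm (k := 0) (fun i : Fin n => ((-1, s + ε * i) : ℝ × ℝ)) ?_ ?_ L ?_
  · intro i; simp
  · intro i j hij
    have h1 : (i : ℝ) - j ≠ 0 := sub_ne_zero.2 (by exact_mod_cast Fin.val_ne_of_ne hij)
    have h2 : cross (-1, s + ε * i) (-1, s + ε * j) = ε * (i - j) := by
      simp only [cross]; ring
    rw [h2]
    exact mul_ne_zero hε'.ne' h1
  · intro q hq
    rw [← totalDegree_zero_iff_isHomogeneous, totalDegree_eq_zero_iff_eq_C] at hq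
    rw [hq, mul_comm, C_mul', map_smul]
    simp only [hann]
    exact smul_eq_zero_of_right _ hs

end UpperBound

section LowerBound

/-- The linear substitution `x ↦ lin a`, `y ↦ lin b`. -/
noncomputable def linSubst (a b : ℝ × ℝ) : MvPolynomial (Fin 2) ℝ →ₐ[ℝ] MvPolynomial (Fin 2) ℝ :=
  aeval ![lin a, lin b]

lemma linSubst_lin (a b p : ℝ × ℝ) : linSubst a b (lin p) = lin (p.1 • a + p.2 • b) := by
  rw [lin_smul_add, lin]
  simp [linSubst, algebraMap_eq]

lemma linSubst_C (a b : ℝ × ℝ) (c : ℝ) : linSubst a b (C c) = C c := by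
  simp [linSubst, algebraMap_eq]

lemma HasDistinctRealRoots.linSubst {n : ℕ} {f : MvPolynomial (Fin 2) ℝ}
    (h : HasDistinctRealRoots f n) {a b : ℝ × ℝ} (hab : cross a b ≠ 0) :
    HasDistinctRealRoots (linSubst a b f) n := by
  obtain ⟨c, l, hc, hl, hll, rfl⟩ := h
  refine ⟨c, fun i => (l i).1 • a + (l i).2 • b, hc, fun i hi => hl i ?_, fun i j hij => ?_, ?_⟩
  · have h1 : (l i).1 * a.1 + (l i).2 * b.1 = 0 := congrArg Prod.fst hi
    have h2 : (l i).1 * a.2 + (l i).2 * b.2 = 0 := congrArg Prod.snd hi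
    have h3 : (l i).1 * cross a b = 0 := by
      simp only [cross]; linear_combination b.2 * h1 - b.1 * h2
    have h4 : (l i).2 * cross a b = 0 := by
      simp only [cross]; linear_combination a.1 * h2 - a.2 * h1
    exact Prod.ext ((mul_eq_zero.1 h3).resolve_right hab) ((mul_eq_zero.1 h4).resolve_right hab)
  · have h1 := mul_ne_zero (hll i j hij) hab
    contrapose! h1
    simp only [cross, Prod.fst_add, Prod.snd_add, Prod.smul_fst, Prod.smul_snd, smul_eq_mul] at h1 ⊢
    linear_combination h1
  · rw [map_mul, map_prod, linSubst_C]
    simp only [linSubst_lin]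

lemma pderiv_zero_lin_pow (p : ℝ × ℝ) (n : ℕ) :
    pderiv 0 (lin p ^ (n + 1)) = C ((n + 1) * p.1) * lin p ^ n := by
  have h : pderiv 0 (lin p) = C p.1 := by
    simp [lin, pderiv_X]
  rw [pderiv_pow, h, Nat.add_sub_cancel, C_mul]
  simp
  ring

lemma dehom_pderiv_zero (g : MvPolynomial (Fin 2) ℝ) :
    dehom (pderiv 0 g) = Polynomial.derivative (dehom g) := by
  induction g using MvPolynomial.induction_on with
  | C a => simp
  | add p q hp hq => simp only [map_add, hp, hq]
  | mul_X p i hp =>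
    rw [pderiv_mul, map_add, map_mul, map_mul, hp, map_mul, Polynomial.derivative_mul]
    fin_cases i <;> simp [dehom, pderiv_X]

lemma HasDistinctRealRoots.isHomogeneous {n : ℕ} {f : MvPolynomial (Fin 2) ℝ}
    (h : HasDistinctRealRoots f n) : f.IsHomogeneous n := by
  obtain ⟨c, l, -, -, -, rfl⟩ := h
  refine IsHomogeneous.C_mul ?_ c
  simpa using isHomogeneous_prod Finset.univ _ fun i => isHomogeneous_lin (l i)

lemma HasDistinctRealRoots.ne_zero {n : ℕ} {f : MvPolynomial (Fin 2) ℝ}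
    (h : HasDistinctRealRoots f n) : f ≠ 0 := by
  obtain ⟨c, l, hc, hl, -, rfl⟩ := h
  refine mul_ne_zero (C_ne_zero.2 hc) (Finset.prod_ne_zero_iff.2 fun i _ h0 => ?_)
  have h1 := evalAt_lin (l i) (l i)
  rw [h0, map_zero] at h1
  nlinarith [sq_add_sq_pos (hl i)]

lemma HasDistinctRealRoots.le_card_roots {n : ℕ} {f : MvPolynomial (Fin 2) ℝ}
    (h : HasDistinctRealRoots f (n + 1)) : n ≤ (dehom f).natDegree ∧
      (dehom f).natDegree ≤ (dehom f).roots.toFinset.card := by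
  have hP0 : dehom f ≠ 0 := fun h0 => h.ne_zero (eq_zero_of_dehom_eq_zero h.isHomogeneous h0)
  obtain ⟨c, l, hc, -, hll, rfl⟩ := h
  set P := dehom (C c * ∏ i, lin (l i)) with hPdef
  have hP : P = Polynomial.C c *
      ∏ i, (Polynomial.C (l i).1 * Polynomial.X + Polynomial.C (l i).2) := by
    rw [hPdef, map_mul, dehom_C, map_prod]
    simp only [dehom_lin]
  classical
  set S := Finset.univ.filter fun i => (l i).1 ≠ 0 with hS
  have hSmem : ∀ i, i ∈ S ↔ (l i).1 ≠ 0 := fun i => by simp [hS]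
  have hcard : n ≤ S.card := by
    have h1 : (Finset.univ.filter fun i => ¬ (l i).1 ≠ 0).card ≤ 1 := by
      refine Finset.card_le_one.2 fun i hi j hj => ?_
      by_contra hij
      simp only [Finset.mem_filter, Finset.mem_univ, true_and, not_not] at hi hj
      exact hll i j hij (by simp [hi, hj])
    have h2 := Finset.card_filter_add_card_filter_not (s := (Finset.univ : Finset (Fin (n + 1))))
      (fun i => (l i).1 ≠ 0)
    rw [Finset.card_univ, Fintype.card_fin] at h2
    lia
  have hroots : S.card ≤ P.roots.toFinset.card := by
    refine Finset.card_le_card_of_injOn (fun i => -(l i).2 / (l i).1) ?_ ?_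
    · intro i hi
      have hi' := (hSmem i).1 hi
      have : P.eval (-(l i).2 / (l i).1) = 0 := by
        rw [hP, Polynomial.eval_mul, Polynomial.eval_prod]
        refine mul_eq_zero_of_right _ (Finset.prod_eq_zero (Finset.mem_univ i) ?_)
        simp only [Polynomial.eval_add, Polynomial.eval_mul, Polynomial.eval_C, Polynomial.eval_X]
        field_simp
        ring
      simpa [hP0] using this
    · intro i hi j hj hij
      have hi' := (hSmem i).1 hi
      have hj' := (hSmem j).1 hj
      by_contra hne
      refine hll i j hne ?_
      dsimp only at hij
      field_simp at hij
      linarith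
  have hdeg : P.natDegree ≤ S.card := by
    rw [hP]
    refine (Polynomial.natDegree_C_mul_le _ _).trans ((Polynomial.natDegree_prod_le _ _).trans ?_)
    rw [Finset.card_filter]
    refine Finset.sum_le_sum fun i _ => ?_
    split_ifs with hi
    · exact Polynomial.natDegree_linear_le
    · rw [not_not] at hi
      simp [hi]
  exact ⟨hcard.trans (hroots.trans ((Multiset.toFinset_card_le _).trans
    (Polynomial.card_roots' P))), hdeg.trans hroots⟩

lemma hasDistinctRealRoots_of_le_card_roots {n : ℕ} {g : MvPolynomial (Fin 2) ℝ}
    (hg : g.IsHomogeneous (n + 1)) (h0 : g ≠ 0) (hn : n ≤ (dehom g).natDegree)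
    (hcard : (dehom g).natDegree ≤ (dehom g).roots.toFinset.card) :
    HasDistinctRealRoots g (n + 1) := by
  set P := dehom g with hP
  have hP0 : P ≠ 0 := fun h => h0 (eq_zero_of_dehom_eq_zero hg h)
  have hle := Multiset.toFinset_card_le P.roots
  have hle' := Polynomial.card_roots' P
  have hnodup : P.roots.Nodup := Multiset.toFinset_card_eq_card_iff_nodup.1 (by lia)
  have hfac : P = Polynomial.C P.leadingCoeff *
      ∏ r ∈ P.roots.toFinset, (Polynomial.X - Polynomial.C r) := by
    conv_lhs => rw [← Polynomial.C_leadingCoeff_mul_prod_multiset_X_sub_C (p := P) (by lia)]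
    rw [Finset.prod_eq_multiset_prod, Multiset.toFinset_val, hnodup.dedup]
  have hlc : P.leadingCoeff ≠ 0 := Polynomial.leadingCoeff_ne_zero.2 hP0
  have henum : ∀ k, P.roots.toFinset.card = k → ∃ r : Fin k → ℝ, Function.Injective r ∧
      P = Polynomial.C P.leadingCoeff * ∏ i, (Polynomial.X - Polynomial.C (r i)) := by
    intro k hk
    refine ⟨fun i => ((P.roots.toFinset.equivFinOfCardEq hk).symm i : ℝ),
      Subtype.val_injective.comp (Equiv.injective _), ?_⟩
    conv_lhs => rw [hfac]
    rw [Equiv.prod_comp (P.roots.toFinset.equivFinOfCardEq hk).symm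
      (fun x => Polynomial.X - Polynomial.C (x : ℝ)), Finset.prod_coe_sort P.roots.toFinset
      (fun x => Polynomial.X - Polynomial.C x)]
  have hlin : ∀ r : ℝ, Polynomial.X - Polynomial.C r = dehom (lin (1, -r)) := fun r => by
    rw [dehom_lin]
    simp [sub_eq_add_neg]
  have hmax := natDegree_dehom_le hg
  rcases (by lia : P.roots.toFinset.card = n + 1 ∨ P.roots.toFinset.card = n) with hk | hk
  · obtain ⟨r, hr, e⟩ := henum _ hk
    have : HasDistinctRealRoots (C P.leadingCoeff * ∏ i, lin (1, -r i)) (n + 1) := by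
      refine ⟨_, _, hlc, fun i => by simp, fun i j hij => ?_, rfl⟩
      simpa [neg_add_eq_zero] using fun h => hij (hr h.symm)
    convert this
    refine dehom_injOn hg this.isHomogeneous ?_
    rw [map_mul, dehom_C, map_prod, ← hP]
    conv_lhs => rw [e]
    simp only [hlin]
  · obtain ⟨r, hr, e⟩ := henum _ hk
    have : HasDistinctRealRoots (C P.leadingCoeff *
        ∏ i, lin ((Fin.cons (0, 1) fun i => (1, -r i) : Fin (n + 1) → ℝ × ℝ) i)) (n + 1) := by
      refine ⟨_, _, hlc, Fin.cases (by simp) fun i => by simp, ?_, rfl⟩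
      refine Fin.cases (Fin.cases (fun h => absurd rfl h) fun j _ => by simp)
          fun i => Fin.cases (fun _ => by simp) fun j hij => ?_
      have hij' : i ≠ j := fun h => hij (congrArg _ h)
      simpa [neg_add_eq_zero] using fun h => hij' (hr h.symm)
    convert this
    refine dehom_injOn hg this.isHomogeneous ?_
    rw [map_mul, dehom_C, map_prod, Fin.prod_univ_succ, ← hP]
    simp only [Fin.cons_zero, Fin.cons_succ]
    rw [dehom_lin (0, 1)]
    conv_lhs => rw [e]
    simp [hlin]

/-- Rolle's theorem for binary forms. -/
lemma HasDistinctRealRoots.pderiv_zero {n : ℕ} {g : MvPolynomial (Fin 2) ℝ}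
    (h : HasDistinctRealRoots g (n + 2)) : HasDistinctRealRoots (pderiv 0 g) (n + 1) := by
  obtain ⟨h1, h2⟩ := h.le_card_roots
  have h3 := Polynomial.card_roots_toFinset_le_derivative (dehom g)
  have h4 := Polynomial.natDegree_derivative (dehom g)
  rw [← dehom_pderiv_zero] at h3 h4
  refine hasDistinctRealRoots_of_le_card_roots h.isHomogeneous.pderiv ?_ (by lia) (by lia)
  intro h0
  have h5 := dehom_pderiv_zero g
  rw [h0, map_zero] at h5
  have h6 := Polynomial.derivative_eq_zero.1 h5.symm
  lia

lemma HasDistinctRealRoots.le_of_waringDecomp {r n : ℕ} {f : MvPolynomial (Fin 2) ℝ}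
    (h : HasDistinctRealRoots f (n + 1)) (hW : WaringDecomp f (n + 1) r) : n + 1 ≤ r := by
  induction r generalizing n f with
  | zero =>
    obtain ⟨lam, l, e⟩ := hW
    exact absurd (by simpa using e) h.ne_zero
  | succ r ih =>
    rcases n with _ | n
    · lia
    obtain ⟨lam, l, e⟩ := hW
    rw [Fin.sum_univ_succ] at e
    by_cases hl : l 0 = 0
    · have : n + 1 + 1 ≤ r := ih h ⟨fun i => lam i.succ, fun i => l i.succ, by
        rw [e, hl]; simp [lin]⟩
      lia
    · set a : ℝ × ℝ := ((l 0).2, (l 0).1) with ha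
      set b : ℝ × ℝ := (-(l 0).1, (l 0).2) with hb
      have hab : cross a b ≠ 0 := by
        have : cross a b = (l 0).1 ^ 2 + (l 0).2 ^ 2 := by simp only [cross, ha, hb]; ring
        rw [this]
        exact (sq_add_sq_pos hl).ne'
      have h0 : ((l 0).1 • a + (l 0).2 • b).1 = 0 := by
        simp only [ha, hb, Prod.fst_add, Prod.smul_fst, smul_eq_mul]; ring
      have hd := (h.linSubst hab).pderiv_zero
      have : n + 1 ≤ r := ih hd ⟨fun i => lam i.succ * ((n + 1 : ℕ) + 1) *
        ((l i.succ).1 • a + (l i.succ).2 • b).1, fun i => (l i.succ).1 • a + (l i.succ).2 • b, by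
          rw [e]
          simp only [map_add, map_sum, map_mul, map_pow, linSubst_C, linSubst_lin, pderiv_C_mul,
            pderiv_zero_lin_pow, h0, mul_zero, C_0, zero_mul, zero_add, ← mul_assoc]⟩
      lia

end LowerBound

section RealRank

lemma not_squarefree_map_of_mul_self_lin_dvd {f : MvPolynomial (Fin 2) ℝ} {p : ℝ × ℝ}
    (h : lin p * lin p ∣ f) : ¬ Squarefree (MvPolynomial.map (algebraMap ℝ ℂ) f) := by
  intro hsf
  have h1 := hsf _ (by simpa only [map_mul] using map_dvd (MvPolynomial.map (algebraMap ℝ ℂ)) h)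
  have h2 := h1.map (MvPolynomial.eval ![(-p.2 : ℂ), (p.1 : ℂ)])
  refine h2.ne_zero ?_
  simp [lin]
  ring

/-- A form without multiple complex roots either has distinct real roots or a nonreal root. -/
lemma hasDistinctRealRoots_or_hasNonrealRoot {n : ℕ} {f : MvPolynomial (Fin 2) ℝ}
    (hf : f.IsHomogeneous n) (hsf : Squarefree (MvPolynomial.map (algebraMap ℝ ℂ) f)) :
    HasDistinctRealRoots f n ∨ HasNonrealRoot (dehom f) := by
  refine or_iff_not_imp_right.2 fun hz => ?_
  obtain ⟨c, l, hl, rfl⟩ := exists_eq_prod_lin_of_splits hf (splits_of_forall_im_eq_zero fun z h0 =>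
    by_contra fun him => hz ⟨z, him, h0⟩)
  refine ⟨c, l, fun hc => ?_, hl, fun i j hij hcr => ?_, rfl⟩
  · simp [hc] at hsf
  · obtain ⟨k, hk⟩ := exists_smul_of_cross_eq_zero (hl i) hcr
    refine not_squarefree_map_of_mul_self_lin_dvd (p := l i) ?_ hsf
    refine Dvd.dvd.mul_left ?_ _
    rw [← Finset.mul_prod_erase _ _ (Finset.mem_univ i)]
    refine mul_dvd_mul_left _ ?_
    have h1 : lin (l j) ∣ ∏ x ∈ Finset.univ.erase i, lin (l x) :=
      Finset.dvd_prod_of_mem _ (Finset.mem_erase.2 ⟨hij.symm, Finset.mem_univ j⟩)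
    refine dvd_trans ?_ h1
    rw [hk, lin_smul]
    exact dvd_mul_left _ _

end RealRank

theorem stmt_14 (n : ℕ) (hn : 3 ≤ n) (f : MvPolynomial (Fin 2) ℝ)
    (hhom : f.IsHomogeneous n)
    (hsf : Squarefree (MvPolynomial.map (algebraMap ℝ ℂ) f)) :
    RealRank f n = n ↔ HasDistinctRealRoots f n := by
  constructor
  · intro hrank
    refine (hasDistinctRealRoots_or_hasNonrealRoot hhom hsf).resolve_right fun hz => ?_
    have hf0 : f ≠ 0 := by
      rintro rfl
      simp at hsf
    obtain ⟨m, rfl⟩ := Nat.exists_eq_add_of_le' hn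
    obtain ⟨L, rfl⟩ := exists_genForm_eq hhom
    obtain ⟨v, hv, hvw, hann⟩ :=
      exists_apolar m (fun h => hf0 (eq_zero_of_dehom_eq_zero hhom h)) hz
    have hle : RealRank (genForm (m + 3) L) (m + 3) ≤ m + 2 :=
      Nat.sInf_le (waringDecomp_genForm v hv hvw L hann)
    lia
  · intro h
    have hW := h.waringDecomp (by lia) hhom
    refine le_antisymm (Nat.sInf_le hW) (le_csInf ⟨n, hW⟩ fun r hr => ?_)
    obtain ⟨m, rfl⟩ := Nat.exists_eq_add_of_le' (by lia : 1 ≤ n)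
    exact h.le_of_waringDecomp hr
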